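/- arXiv:2212.01522 — 12 statements merged into one kernel-verified Lean document; each statement's English description precedes it below -/
import Mathlib

section
/- Let D be either the case-(a) matrix D_a or the case-(b) matrix D_b. Fix d > 0 and r ∈ ℝⁿ. Suppose 0 ≤ q < q′, λ, λ′ ∈ ℝ, and there exist positive vectors φ ≫ 0 and ψ ≫ 0 such that (dD + qQ + diag(r))φ = λφ and (dD + q′Q + diag(r))ψ = λ′ψ. Then λ′ < λ. (That is, the principal eigenvalue λ₁(d,q,r) is strictly decreasing in q on [0,∞).) -/
open Matrix Filter

/-- Case (a) diffusion matrix (hypothesis H1, stream-to-lake). -/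
def Da (n : ℕ) : Matrix (Fin n) (Fin n) ℝ := fun i j =>
  if (i : ℕ) + 1 = (j : ℕ) ∨ (j : ℕ) + 1 = (i : ℕ) then 1
  else if i = j then (if (i : ℕ) = 0 ∨ (i : ℕ) = n - 1 then -1 else -2)
  else 0

/-- Case (b) diffusion matrix (hypothesis H1*, stream-to-ocean). -/
def Db (n : ℕ) : Matrix (Fin n) (Fin n) ℝ := fun i j =>
  if (i : ℕ) + 1 = (j : ℕ) ∨ (j : ℕ) + 1 = (i : ℕ) then 1
  else if i = j then (if (i : ℕ) = 0 then -1 else -2)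
  else 0

/-- Advection (drift) matrix Q. -/
def Qm (n : ℕ) : Matrix (Fin n) (Fin n) ℝ := fun i j =>
  if (j : ℕ) + 1 = (i : ℕ) then 1 else if i = j then -1 else 0

lemma aux_key (d q q' x y : ℝ) (hd : 0 < d) (hq : 0 ≤ q) (hqq : q < q') (hx : 0 < x) (hy : 0 < y)
    (h : (q' - q) / 2 < d * (y - x)) : (d + q') / y - (d + q) / x < (q' - q) / 2 := by
  by_contra hc
  push Not at hc
  obtain ⟨a, ha, rfl⟩ : ∃ a : ℝ, 0 < a ∧ a ^ 2 = d := ⟨√d, by positivity, Real.sq_sqrt hd.le⟩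
  obtain ⟨b, hb, hb2⟩ : ∃ b : ℝ, 0 < b ∧ b ^ 2 = a ^ 2 + q :=
    ⟨√(a ^ 2 + q), by positivity, Real.sq_sqrt (by positivity)⟩
  have hq' : 0 ≤ q' := by linarith
  obtain ⟨c, hcp, hc2⟩ : ∃ b : ℝ, 0 < b ∧ b ^ 2 = a ^ 2 + q' :=
    ⟨√(a ^ 2 + q'), by positivity, Real.sq_sqrt (by positivity)⟩
  have hab : a ≤ b := by nlinarith
  have hbc : b < c := by nlinarith
  rw [← hb2, ← hc2] at hc
  have hδ : q' - q = c ^ 2 - b ^ 2 := by linarith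
  rw [hδ] at h hc
  set e := (c ^ 2 - b ^ 2) / 2 with he
  have he0 : 0 < e := by nlinarith
  have h1 : e + b ^ 2 / x ≤ c ^ 2 / y := by linarith
  have h2 : a ^ 2 * x + e < a ^ 2 * y := by linarith
  have h3 : (e + b ^ 2 / x) * (a ^ 2 * x + e) < c ^ 2 / y * (a ^ 2 * y) :=
    mul_lt_mul' h1 h2 (by positivity) (by positivity)
  have h4 : c ^ 2 / y * (a ^ 2 * y) = (c * a) ^ 2 := by field_simp
  have h5 : (e + a * b) ^ 2 ≤ (e + b ^ 2 / x) * (a ^ 2 * x + e) := by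
    have : (e + b ^ 2 / x) * (a ^ 2 * x + e) - (e + a * b) ^ 2 = e * (a * x - b) ^ 2 / x := by
      field_simp
      ring
    have : 0 ≤ e * (a * x - b) ^ 2 / x := by positivity
    linarith
  have h6 : e + a * b < c * a := by
    apply lt_of_pow_lt_pow_left₀ 2 (by positivity)
    linarith
  nlinarith

lemma aux_row (n : ℕ) (D : Matrix (Fin n) (Fin n) ℝ) (hD : D = Da n ∨ D = Db n)
    (d q lam : ℝ) (r φ : Fin n → ℝ)
    (heig : (d • D + q • Qm n + Matrix.diagonal r).mulVec φ = lam • φ) (i : Fin n) :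
    (∑ j : Fin n, if (j : ℕ) = i + 1 then d * φ j else 0)
      + (∑ j : Fin n, if (j : ℕ) + 1 = i then (d + q) * φ j else 0)
      + (d * D i i - q + r i) * φ i = lam * φ i := by
  have h := congrFun heig i
  simp only [Matrix.mulVec, dotProduct, Pi.smul_apply, smul_eq_mul] at h
  rw [← h]
  have : (d * D i i - q + r i) * φ i
      = ∑ j : Fin n, if j = i then (d * D i i - q + r i) * φ j else 0 := by simp
  rw [this, ← Finset.sum_add_distrib, ← Finset.sum_add_distrib]
  refine Finset.sum_congr rfl fun j _ => ?_
  simp only [Matrix.add_apply, Matrix.smul_apply, smul_eq_mul, Qm]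
  by_cases hij : j = i
  · subst hij
    simp only [Matrix.diagonal_apply_eq, if_true, if_neg (show ¬ (j : ℕ) = j + 1 by omega),
      if_neg (show ¬ (j : ℕ) + 1 = j by omega)]
    ring
  · have hv : (j : ℕ) ≠ i := fun h => hij (Fin.ext h)
    have hij' : ¬ i = j := fun h => hij h.symm
    have hDij : D i j = if (i : ℕ) + 1 = (j : ℕ) ∨ (j : ℕ) + 1 = (i : ℕ) then 1 else 0 := by
      rcases hD with rfl | rfl <;> simp [Da, Db, hij']
    rw [hDij, Matrix.diagonal_apply_ne _ hij']
    by_cases h1 : (j : ℕ) = i + 1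
    · have h2 : ¬ (j : ℕ) + 1 = i := by omega
      have h3 : (i : ℕ) + 1 = j := h1.symm
      simp only [if_pos h1, if_neg h2, if_neg hij, if_neg hij', if_pos (Or.inl h3 : (i : ℕ) + 1 = (j : ℕ) ∨ (j : ℕ) + 1 = (i : ℕ))]
      ring
    · have h1' : ¬ (i : ℕ) + 1 = j := by omega
      by_cases h2 : (j : ℕ) + 1 = i
      · simp [h1, h2, hij, hij']
      · simp [h1, h1', h2, hij, hij']

lemma aux_sum_up (n k : ℕ) (hk : k < n) (f : Fin n → ℝ) :
    (∑ j : Fin n, if (j : ℕ) = k then f j else 0) = f ⟨k, hk⟩ := by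
  rw [Finset.sum_eq_single ⟨k, hk⟩]
  · simp
  · intro b _ hb
    rw [if_neg fun h => hb (Fin.ext h)]
  · simp

/-- the principal eigenvalue `λ₁(d,q,r)` is strictly decreasing in `q` on `[0,∞)`,
for case (a) and case (b). -/
theorem stmt_0 (n : ℕ) (hn : 2 ≤ n) (D : Matrix (Fin n) (Fin n) ℝ)
    (hD : D = Da n ∨ D = Db n)
    (d : ℝ) (hd : 0 < d) (r : Fin n → ℝ)
    (q q' lam lam' : ℝ) (hq : 0 ≤ q) (hqq' : q < q')
    (φ ψ : Fin n → ℝ) (hφ : ∀ i, 0 < φ i) (hψ : ∀ i, 0 < ψ i)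
    (heig : (d • D + q • Qm n + Matrix.diagonal r).mulVec φ = lam • φ)
    (heig' : (d • D + q' • Qm n + Matrix.diagonal r).mulVec ψ = lam' • ψ) :
    lam' < lam := by
  by_contra hlam
  push Not at hlam
  have R := aux_row n D hD d q lam r φ heig
  have R' := aux_row n D hD d q' lam' r ψ heig'
  have step : ∀ k (hk : k + 1 < n), (q' - q) / 2 <
      d * (ψ ⟨k + 1, hk⟩ / ψ ⟨k, by omega⟩ - φ ⟨k + 1, hk⟩ / φ ⟨k, by omega⟩) →
      (d + q') * ψ ⟨k, by omega⟩ / ψ ⟨k + 1, hk⟩ - (d + q) * φ ⟨k, by omega⟩ / φ ⟨k + 1, hk⟩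
        < (q' - q) / 2 := by
    intro k hk h
    have := aux_key d q q' _ _ hd hq hqq' (div_pos (hφ ⟨k + 1, hk⟩) (hφ ⟨k, by omega⟩))
      (div_pos (hψ ⟨k + 1, hk⟩) (hψ ⟨k, by omega⟩)) h
    simpa only [div_div_eq_mul_div] using this
  have main : ∀ k (hk : k + 1 < n), (q' - q) / 2 <
      d * (ψ ⟨k + 1, hk⟩ / ψ ⟨k, by omega⟩ - φ ⟨k + 1, hk⟩ / φ ⟨k, by omega⟩) := by
    intro k
    induction k with
    | zero =>
      intro hk
      have e1 := R ⟨0, by omega⟩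
      have e2 := R' ⟨0, by omega⟩
      have p1 := hφ ⟨0, by omega⟩
      have p2 := hψ ⟨0, by omega⟩
      simp only [aux_sum_up n (0 + 1) hk, Nat.succ_ne_zero, if_false, Finset.sum_const_zero] at e1 e2
      have f1 := congrArg (· / φ ⟨0, by omega⟩) e1
      have f2 := congrArg (· / ψ ⟨0, by omega⟩) e2
      simp only [add_div, mul_div_assoc, div_self p1.ne', div_self p2.ne', zero_div] at f1 f2
      linarith
    | succ k ih =>
      intro hk
      have hs := step k (by omega) (ih (by omega))
      have e1 := R ⟨k + 1, by omega⟩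
      have e2 := R' ⟨k + 1, by omega⟩
      have p1 := hφ ⟨k + 1, by omega⟩
      have p2 := hψ ⟨k + 1, by omega⟩
      simp only [aux_sum_up n (k + 1 + 1) hk, add_left_inj, aux_sum_up n k (by omega)] at e1 e2
      have f1 := congrArg (· / φ ⟨k + 1, by omega⟩) e1
      have f2 := congrArg (· / ψ ⟨k + 1, by omega⟩) e2
      simp only [add_div, mul_div_assoc, div_self p1.ne', div_self p2.ne', zero_div] at f1 f2 hs
      linarith
  obtain ⟨k, rfl⟩ : ∃ k, n = k + 2 := ⟨n - 2, by omega⟩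
  have hs := step k (by omega) (main k (by omega))
  have e1 := R ⟨k + 1, by omega⟩
  have e2 := R' ⟨k + 1, by omega⟩
  have p1 := hφ ⟨k + 1, by omega⟩
  have p2 := hψ ⟨k + 1, by omega⟩
  have hne : ∀ j : Fin (k + 2), ¬ (j : ℕ) = k + 1 + 1 := fun j => by omega
  simp only [hne, if_false, Finset.sum_const_zero, add_left_inj,
    aux_sum_up (k + 2) k (by omega)] at e1 e2
  have f1 := congrArg (· / φ ⟨k + 1, by omega⟩) e1
  have f2 := congrArg (· / ψ ⟨k + 1, by omega⟩) e2
  simp only [add_div, mul_div_assoc, div_self p1.ne', div_self p2.ne', zero_div] at f1 f2 hs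
  linarith
end

section
/- Let D be either the case-(a) matrix D_a or the case-(b) matrix D_b. Fix d > 0 and r ∈ ℝⁿ. For every M ∈ ℝ there exists Q₀ > 0 such that for all q > Q₀: if λ ∈ ℝ and φ ≫ 0 satisfy (dD + qQ + diag(r))φ = λφ, then λ < M. (That is, the principal eigenvalue λ₁(d,q,r) tends to −∞ as q → ∞.) -/
open Matrix Filter

lemma aux_le_one {n : ℕ} (p : Fin n → Prop) [DecidablePred p]
    (h : ∀ a b, p a → p b → a = b) : (∑ i, if p i then (1 : ℝ) else 0) ≤ 1 := by
  rw [Finset.sum_boole]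
  have : (Finset.univ.filter p).card ≤ 1 := by
    rw [Finset.card_le_one]
    intro a ha b hb
    simp at ha hb
    exact h a b ha hb
  exact_mod_cast this

lemma aux_entry {n : ℕ} (D : Matrix (Fin n) (Fin n) ℝ) (hD : D = Da n ∨ D = Db n) (i j : Fin n) :
    D i j ≤ (if (i : ℕ) + 1 = (j : ℕ) then 1 else 0) + (if (j : ℕ) + 1 = (i : ℕ) then 1 else 0) := by
  rcases hD with rfl | rfl
  · unfold Da
    split_ifs <;> first | (exfalso; omega) | norm_num
  · unfold Db
    split_ifs <;> first | (exfalso; omega) | norm_num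

lemma aux_col {n : ℕ} (D : Matrix (Fin n) (Fin n) ℝ) (hD : D = Da n ∨ D = Db n)
    (d q : ℝ) (hd : 0 < d) (hq : 0 < q) (r : Fin n → ℝ) (j : Fin n) :
    ∑ i : Fin n, (1/2 : ℝ)^(i : ℕ) * (d • D + q • Qm n + Matrix.diagonal r) i j
      ≤ (3 * d - q / 2 + r j) * (1/2 : ℝ)^(j : ℕ) := by
  have h1 := aux_le_one (fun i : Fin n => (i : ℕ) + 1 = (j : ℕ)) (fun a b ha hb => by ext; omega)
  have h2 := aux_le_one (fun i : Fin n => (j : ℕ) + 1 = (i : ℕ)) (fun a b ha hb => by ext; omega)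
  have h3 : (∑ i : Fin n, if i = j then (1 : ℝ) else 0) = 1 := by simp
  have hp : 0 < (1/2 : ℝ)^(j : ℕ) := by positivity
  have key : ∀ i : Fin n, (1/2 : ℝ)^(i : ℕ) * (d • D + q • Qm n + Matrix.diagonal r) i j
      ≤ (2 * d * (1/2 : ℝ)^(j : ℕ)) * (if (i : ℕ) + 1 = (j : ℕ) then 1 else 0)
        + ((d + q) / 2 * (1/2 : ℝ)^(j : ℕ)) * (if (j : ℕ) + 1 = (i : ℕ) then 1 else 0)
        + ((r j - q) * (1/2 : ℝ)^(j : ℕ)) * (if i = j then 1 else 0) := by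
    intro i
    have he := mul_le_mul_of_nonneg_left (aux_entry D hD i j) hd.le
    have hpi : 0 < (1/2 : ℝ)^(i : ℕ) := by positivity
    have he2 := mul_le_mul_of_nonneg_left he hpi.le
    simp only [Matrix.add_apply, Matrix.smul_apply, smul_eq_mul, Matrix.diagonal_apply, Qm]
    by_cases c1 : (i : ℕ) + 1 = (j : ℕ)
    · have c2 : ¬ ((j : ℕ) + 1 = (i : ℕ)) := by omega
      have c3 : i ≠ j := by rintro rfl; omega
      have e : (1/2 : ℝ)^(j : ℕ) = (1/2 : ℝ)^(i : ℕ) * (1/2) := by rw [← c1, pow_succ]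
      simp only [c1, c2, c3, if_true, if_false] at he2 ⊢
      rw [e]; linarith
    · by_cases c2 : (j : ℕ) + 1 = (i : ℕ)
      · have c3 : i ≠ j := by rintro rfl; omega
        have e : (1/2 : ℝ)^(i : ℕ) = (1/2 : ℝ)^(j : ℕ) * (1/2) := by rw [← c2, pow_succ]
        simp only [c1, c2, c3, if_true, if_false] at he2 ⊢
        rw [e] at he2 ⊢; linarith
      · by_cases c3 : i = j
        · subst c3
          simp only [c1, if_true, if_false] at he2 ⊢
          linarith
        · simp only [c1, c2, c3, if_true, if_false] at he2 ⊢
          linarith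
  refine (Finset.sum_le_sum fun i _ => key i).trans ?_
  rw [Finset.sum_add_distrib, Finset.sum_add_distrib, ← Finset.mul_sum, ← Finset.mul_sum,
    ← Finset.mul_sum, h3]
  have a1 := mul_le_mul_of_nonneg_left h1 (show 0 ≤ 2 * d * (1/2 : ℝ)^(j : ℕ) by positivity)
  have a2 := mul_le_mul_of_nonneg_left h2 (show 0 ≤ (d + q) / 2 * (1/2 : ℝ)^(j : ℕ) by positivity)
  have a3 : 0 < d * (1/2 : ℝ)^(j : ℕ) := by positivity
  linarith

/-- the principal eigenvalue `λ₁(d,q,r)` tends to `-∞` as `q → ∞`,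
for case (a) and case (b). -/
theorem stmt_1 (n : ℕ) (hn : 2 ≤ n) (D : Matrix (Fin n) (Fin n) ℝ)
    (hD : D = Da n ∨ D = Db n)
    (d : ℝ) (hd : 0 < d) (r : Fin n → ℝ) (M : ℝ) :
    ∃ Q₀ : ℝ, 0 < Q₀ ∧ ∀ q : ℝ, Q₀ < q →
      ∀ (lam : ℝ) (φ : Fin n → ℝ), (∀ i, 0 < φ i) →
        (d • D + q • Qm n + Matrix.diagonal r).mulVec φ = lam • φ →
        lam < M := by
  have hR : ∀ j, r j ≤ ∑ i, |r i| := fun j => (le_abs_self _).trans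
    (Finset.single_le_sum (f := fun i => |r i|) (fun i _ => abs_nonneg _) (Finset.mem_univ j))
  set R := ∑ i, |r i|
  refine ⟨max 1 (2 * (3 * d + R - M)), by positivity, ?_⟩
  intro q hq lam φ hφ h
  have hq1 : 0 < q := lt_trans one_pos ((le_max_left _ _).trans_lt hq)
  have hq2 : 2 * (3 * d + R - M) < q := (le_max_right _ _).trans_lt hq
  set A := d • D + q • Qm n + Matrix.diagonal r with hA
  have hS : 0 < ∑ j : Fin n, (1/2 : ℝ)^(j : ℕ) * φ j :=
    Finset.sum_pos (fun j _ => mul_pos (by positivity) (hφ j)) ⟨⟨0, by omega⟩, Finset.mem_univ _⟩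
  have e : lam * ∑ j : Fin n, (1/2 : ℝ)^(j : ℕ) * φ j
      = ∑ j : Fin n, (∑ i : Fin n, (1/2 : ℝ)^(i : ℕ) * A i j) * φ j := by
    simp only [Finset.sum_mul]
    rw [Finset.sum_comm, Finset.mul_sum]
    refine Finset.sum_congr rfl fun i _ => ?_
    have hi := congrFun h i
    simp only [Matrix.mulVec, dotProduct, Pi.smul_apply, smul_eq_mul] at hi
    rw [mul_left_comm, ← hi, Finset.mul_sum]
    exact Finset.sum_congr rfl fun j _ => by ring
  have b : lam * ∑ j : Fin n, (1/2 : ℝ)^(j : ℕ) * φ j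
      ≤ (3 * d - q / 2 + R) * ∑ j : Fin n, (1/2 : ℝ)^(j : ℕ) * φ j := by
    rw [e, Finset.mul_sum]
    refine Finset.sum_le_sum fun j _ => ?_
    rw [← mul_assoc]
    refine mul_le_mul_of_nonneg_right ?_ (hφ j).le
    refine (aux_col D hD d q hd hq1 r j).trans ?_
    exact mul_le_mul_of_nonneg_right (by linarith [hR j]) (by positivity)
  have := le_of_mul_le_mul_right b hS
  linarith
end

section
/- Fix q ≥ 0 and r ∈ ℝⁿ, and consider case (a). (i) For every ε > 0 there exists δ > 0 such that for every d ∈ (0,δ): if λ ∈ ℝ and φ ≫ 0 satisfy (dD + qQ + diag(r))φ = λφ, then |λ − (max_{1≤i≤n} r_i − q)| < ε. (ii) For every ε > 0 there exists M > 0 such that for every d > M: if λ ∈ ℝ and φ ≫ 0 satisfy (dD + qQ + diag(r))φ = λφ, then |λ − ((Σ_{i=1}^n r_i − q)/n)| < ε. (That is, λ₁(d,q,r) → max_i r_i − q as d → 0 and λ₁(d,q,r) → (Σ_i r_i − q)/n as d → ∞.) -/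
open Matrix Filter

lemma rowEq (N : ℕ) (hN : 1 ≤ N) (d q lam : ℝ) (r φ : Fin (N+1) → ℝ) (f R : ℕ → ℝ)
    (hf : ∀ i : Fin (N+1), f i = φ i) (hR : ∀ i : Fin (N+1), R i = r i) (hfn : f (N+1) = 0)
    (h : (d • Da (N+1) + q • Qm (N+1) + Matrix.diagonal r).mulVec φ = lam • φ)
    (k : ℕ) (hk : k < N + 1) :
    lam * f k = (R k - q - d * (if k = 0 ∨ k = N then 1 else 2)) * f k + d * f (k+1)
      + (if k = 0 then 0 else (d + q) * f (k-1)) := by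
  have h1 := congrFun h ⟨k, hk⟩
  simp only [Matrix.mulVec, dotProduct, Pi.smul_apply, smul_eq_mul] at h1
  rw [← hf] at h1
  simp only at h1
  rw [← h1]
  have h2 : ∀ j : Fin (N+1), (d • Da (N+1) + q • Qm (N+1) + Matrix.diagonal r) ⟨k, hk⟩ j * φ j
      = (fun j : ℕ => (if j = k then
          (R k - q - d * (if k = 0 ∨ k = N then 1 else 2)) * f k else 0)
        + (if j = k + 1 then d * f (k+1) else 0)
        + (if j = k - 1 then (if k = 0 then 0 else (d + q) * f (k-1)) else 0)) (j : ℕ) := by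
    intro j
    have hRk := hR ⟨k, hk⟩
    simp only at hRk
    simp only [Matrix.add_apply, Matrix.smul_apply, smul_eq_mul, Da, Qm, Matrix.diagonal_apply,
      Fin.ext_iff, ← hf, Nat.add_sub_cancel, ← hRk]
    obtain ⟨j, hj⟩ := j
    simp only
    rcases lt_trichotomy j k with hlt | rfl | hgt
    · by_cases h' : j + 1 = k
      · subst h'
        have e4 : ¬ (j = j + 1 + 1) := by omega
        simp [e4]
      · have e1 : ¬ (k + 1 = j) := by omega
        have e2 : ¬ (k = j) := by omega
        have e3 : ¬ (j = k) := by omega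
        have e4 : ¬ (j = k + 1) := by omega
        have e5 : ¬ (j = k - 1) := by omega
        simp [h', e1, e2, e3, e4, e5]
    · by_cases h0 : j = 0
      · subst h0; simp only [Nat.zero_add, zero_ne_one, one_ne_zero, or_self, if_false, true_or, if_true, Nat.zero_sub]; ring
      · have e5 : ¬ (j = j - 1) := by omega
        have e6 : ¬ (j + 1 = j) := by omega
        have e7 : ¬ (j = j + 1) := by omega
        simp only [h0, e5, e6, e7, or_self, false_or, if_false, if_true]
        split_ifs <;> ring
    · have e2 : ¬ (k = j) := by omega
      have e3 : ¬ (j = k) := by omega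
      have e5 : ¬ (j = k - 1) := by omega
      have e6 : ¬ (j + 1 = k) := by omega
      by_cases h' : j = k + 1
      · subst h'
        simp [e5, e6]
      · have e1 : ¬ (k + 1 = j) := by omega
        simp [h', e1, e2, e3, e5, e6]
  rw [Finset.sum_congr rfl (fun j _ => h2 j)]
  refine (Fin.sum_univ_eq_sum_range (fun j : ℕ => (if j = k then
          (R k - q - d * (if k = 0 ∨ k = N then 1 else 2)) * f k else 0)
        + (if j = k + 1 then d * f (k+1) else 0)
        + (if j = k - 1 then (if k = 0 then 0 else (d + q) * f (k-1)) else 0)) (N+1)).trans ?_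
  rw [Finset.sum_add_distrib,
    Finset.sum_add_distrib, Finset.sum_ite_eq', Finset.sum_ite_eq', Finset.sum_ite_eq']
  have e1 : k - 1 < N + 1 := by omega
  simp only [Finset.mem_range, hk, e1, if_true]
  by_cases h3 : k + 1 < N + 1
  · simp only [h3, if_true]
  · have : k = N := by omega
    subst this
    simp [hfn]

lemma part1 (N : ℕ) (d q lam m s : ℝ) (hq : 0 ≤ q) (hd : 0 < d) (hs : 0 < s) (f R : ℕ → ℝ)
    (hpos : ∀ k < N + 1, 0 < f k) (hfn : f (N+1) = 0)
    (hRm : ∀ k < N + 1, R k ≤ m) (p : ℕ) (hp : p < N + 1) (hpm : R p = m)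
    (row : ∀ k < N + 1, lam * f k = (R k - q - d * (if k = 0 ∨ k = N then 1 else 2)) * f k
      + d * f (k+1) + (if k = 0 then 0 else (d + q) * f (k-1))) :
    m - q - 2 * d ≤ lam ∧ lam ≤ m - q + d / s + (d + q) * s := by
  have hnn : ∀ k ≤ N + 1, 0 ≤ f k := by
    intro k hk
    rcases Nat.lt_or_ge k (N+1) with h | h
    · exact (hpos k h).le
    · rw [show k = N + 1 by omega, hfn]
  constructor
  · have h1 := row p hp
    have h2 : 0 ≤ d * f (p+1) := mul_nonneg hd.le (hnn _ (by omega))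
    have h3 : 0 ≤ (if p = 0 then 0 else (d + q) * f (p-1)) := by
      split_ifs
      · exact le_rfl
      · exact mul_nonneg (by linarith) (hnn _ (by omega))
    have h4 : d * (if p = 0 ∨ p = N then (1:ℝ) else 2) ≤ 2 * d := by
      split_ifs <;> linarith
    have h5 := hpos p hp
    refine le_of_mul_le_mul_right ?_ h5
    have h6 := mul_le_mul_of_nonneg_right h4 h5.le
    rw [h1, hpm]
    nlinarith
  · obtain ⟨i, hi, hmax⟩ := Finset.exists_max_image (Finset.range (N+1)) (fun k => f k * s ^ k)
      ⟨0, by simp⟩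
    rw [Finset.mem_range] at hi
    simp only [Finset.mem_range] at hmax
    have h5 := hpos i hi
    have h1 := row i hi
    have h2 : f (i+1) ≤ f i / s := by
      rcases Nat.lt_or_ge (i+1) (N+1) with h | h
      · have := hmax _ h
        rw [pow_succ, mul_comm (s^i) s, ← mul_assoc] at this
        rw [le_div_iff₀ hs]
        exact le_of_mul_le_mul_right this (pow_pos hs i)
      · rw [show i + 1 = N + 1 by omega, hfn]; positivity
    have h3 : (if i = 0 then 0 else (d + q) * f (i-1)) ≤ (d + q) * (s * f i) := by
      split_ifs with h0
      · positivity
      · refine mul_le_mul_of_nonneg_left ?_ (by linarith)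
        obtain ⟨j, rfl⟩ : ∃ j, i = j + 1 := ⟨i - 1, by omega⟩
        have := hmax j (by omega)
        rw [pow_succ, mul_comm (s^j) s, ← mul_assoc] at this
        have := le_of_mul_le_mul_right this (pow_pos hs j)
        simp only [Nat.add_sub_cancel]
        linarith
    have h4 : 0 ≤ d * (if i = 0 ∨ i = N then (1:ℝ) else 2) := by
      split_ifs <;> linarith
    refine le_of_mul_le_mul_right ?_ h5
    rw [h1]
    have h6 := mul_nonneg h4 h5.le
    have h7 := mul_le_mul_of_nonneg_left h2 hd.le
    have h8 := mul_le_mul_of_nonneg_right (hRm i hi) h5.le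
    have e : d * (f i / s) = d / s * f i := by ring
    rw [e] at h7
    nlinarith

lemma part2 (N : ℕ) (hN : 1 ≤ N) (d q lam K : ℝ) (hq : 0 ≤ q) (hd : 0 < d) (f R : ℕ → ℝ)
    (hpos : ∀ k < N + 1, 0 < f k) (hfn : f (N+1) = 0)
    (hK : K = ∑ k ∈ Finset.range (N+1), |R k|)
    (row : ∀ k < N + 1, lam * f k = (R k - q - d * (if k = 0 ∨ k = N then 1 else 2)) * f k
      + d * f (k+1) + (if k = 0 then 0 else (d + q) * f (k-1))) :
    d * |lam * (N + 1 : ℝ) - (∑ k ∈ Finset.range (N+1), R k - q)| ≤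
      (K + q) * ((N + 1) * (2 * N * (2 * K + 2 * q))) := by
  have flux : ∀ k < N, ∑ j ∈ Finset.range (k+1), (lam - R j) * f j
      = d * (f (k+1) - f k) - q * f k := by
    intro k
    induction k with
    | zero =>
      intro h
      have := row 0 (by omega)
      simp at this
      simp
      linarith
    | succ k ih =>
      intro h
      rw [Finset.sum_range_succ, ih (by omega)]
      have := row (k+1) (by omega)
      have e : ¬ (k + 1 = N) := by omega
      simp [e] at this
      linarith
  have tot : ∑ j ∈ Finset.range (N+1), (lam - R j) * f j = - q * f N := by
    obtain ⟨L, rfl⟩ : ∃ L, N = L + 1 := ⟨N - 1, by omega⟩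
    rw [Finset.sum_range_succ, flux L (by omega)]
    have := row (L+1) (by omega)
    simp [hfn] at this
    linarith
  set S := ∑ j ∈ Finset.range (N+1), f j with hS
  have hSpos : 0 < S := Finset.sum_pos (fun i hi => hpos i (Finset.mem_range.1 hi)) ⟨0, by simp⟩
  have hfS : ∀ k < N + 1, f k ≤ S := fun k hk =>
    Finset.single_le_sum (f := f) (fun i hi => (hpos i (Finset.mem_range.1 hi)).le)
      (Finset.mem_range.2 hk)
  have hRK : ∀ k < N + 1, |R k| ≤ K := fun k hk => by
    rw [hK]
    exact Finset.single_le_sum (f := fun k => |R k|) (fun i hi => abs_nonneg _)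
      (Finset.mem_range.2 hk)
  have hK0 : 0 ≤ K := (abs_nonneg _).trans (hRK 0 (by omega))
  have tot' : lam * S = ∑ j ∈ Finset.range (N+1), R j * f j - q * f N := by
    have : ∑ j ∈ Finset.range (N+1), (lam - R j) * f j
      = lam * S - ∑ j ∈ Finset.range (N+1), R j * f j := by
      rw [hS, Finset.mul_sum, ← Finset.sum_sub_distrib]
      exact Finset.sum_congr rfl fun _ _ => by ring
    linarith
  have hlam : |lam| ≤ K + q := by
    refine le_of_mul_le_mul_right ?_ hSpos
    have : |lam| * S = |lam * S| := by rw [abs_mul, abs_of_pos hSpos]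
    rw [this, tot']
    refine (abs_sub _ _).trans ?_
    have a1 : |∑ j ∈ Finset.range (N+1), R j * f j| ≤ K * S := by
      refine (Finset.abs_sum_le_sum_abs _ _).trans ?_
      rw [hS, Finset.mul_sum]
      refine Finset.sum_le_sum fun j hj => ?_
      have hj := Finset.mem_range.1 hj
      rw [abs_mul, abs_of_pos (hpos j hj)]
      exact mul_le_mul_of_nonneg_right (hRK j hj) (hpos j hj).le
    have a2 : |q * f N| ≤ q * S := by
      rw [abs_of_nonneg (mul_nonneg hq (hpos N (by omega)).le)]
      exact mul_le_mul_of_nonneg_left (hfS N (by omega)) hq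
    linarith
  have step : ∀ k < N, d * |f (k+1) - f k| ≤ (2 * K + 2 * q) * S := by
    intro k hk
    have h1 := flux k hk
    have : d * |f (k+1) - f k| = |∑ j ∈ Finset.range (k+1), (lam - R j) * f j + q * f k| := by
      rw [h1, sub_add_cancel, abs_mul, abs_of_pos hd]
    rw [this]
    refine (abs_add_le _ _).trans ?_
    have a2 : |q * f k| ≤ q * S := by
      rw [abs_of_nonneg (mul_nonneg hq (hpos k (by omega)).le)]
      exact mul_le_mul_of_nonneg_left (hfS k (by omega)) hq
    have a1 : |∑ j ∈ Finset.range (k+1), (lam - R j) * f j| ≤ (2 * K + q) * S := by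
      refine (Finset.abs_sum_le_sum_abs _ _).trans ?_
      rw [hS, Finset.mul_sum]
      refine (Finset.sum_le_sum (g := fun j => (2 * K + q) * f j) fun j hj => ?_).trans
        (Finset.sum_le_sum_of_subset_of_nonneg ?_ ?_)
      · have hj : j < N + 1 := by have := Finset.mem_range.1 hj; omega
        rw [abs_mul, abs_of_pos (hpos j hj)]
        refine mul_le_mul_of_nonneg_right ?_ (hpos j hj).le
        have := abs_sub lam (R j)
        have := hRK j hj
        linarith
      · exact Finset.range_subset_range.2 (by omega)
      · intro j hj _
        exact mul_nonneg (by positivity) (hpos j (Finset.mem_range.1 hj)).le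
    linarith
  set E := (2 * K + 2 * q) * S with hE
  have hE0 : 0 ≤ E := by positivity
  have tele : ∀ k ≤ N, d * |f k - f 0| ≤ k * E := by
    intro k
    induction k with
    | zero => simp
    | succ k ih =>
      intro h
      have h1 := ih (by omega)
      have h2 := step k (by omega)
      have h3 := mul_le_mul_of_nonneg_left (abs_sub_le (f (k+1)) (f k) (f 0)) hd.le
      push_cast
      linarith
  have tele0 : ∀ k < N + 1, d * |f k - f 0| ≤ N * E := fun k hk =>
    (tele k (by omega)).trans
      (mul_le_mul_of_nonneg_right (by exact_mod_cast (by omega : k ≤ N)) hE0)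
  have dev : ∀ k < N + 1, d * |(N + 1 : ℝ) * f k - S| ≤ (N + 1) * (2 * N * E) := by
    intro k hk
    have : (N + 1 : ℝ) * f k - S = ∑ j ∈ Finset.range (N+1), (f k - f j) := by
      rw [Finset.sum_sub_distrib]; simp [hS]
    rw [this]
    refine (mul_le_mul_of_nonneg_left (Finset.abs_sum_le_sum_abs _ _) hd.le).trans ?_
    rw [Finset.mul_sum]
    refine (Finset.sum_le_card_nsmul _ _ (2 * N * E) fun j hj => ?_).trans (by simp)
    have h1 := tele0 k hk
    have h2 := tele0 j (Finset.mem_range.1 hj)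
    have h3 := mul_le_mul_of_nonneg_left (abs_sub_le (f k) (f 0) (f j)) hd.le
    rw [abs_sub_comm (f 0)] at h3
    linarith
  refine le_of_mul_le_mul_right ?_ hSpos
  have key : (lam * (N + 1 : ℝ) - (∑ k ∈ Finset.range (N+1), R k - q)) * S
      = ∑ k ∈ Finset.range (N+1), R k * ((N + 1 : ℝ) * f k - S) - q * ((N + 1 : ℝ) * f N - S) := by
    have : ∑ k ∈ Finset.range (N+1), R k * ((N + 1 : ℝ) * f k - S)
      = (N + 1 : ℝ) * ∑ k ∈ Finset.range (N+1), R k * f k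
        - (∑ k ∈ Finset.range (N+1), R k) * S := by
      rw [Finset.mul_sum, Finset.sum_mul, ← Finset.sum_sub_distrib]
      exact Finset.sum_congr rfl fun _ _ => by ring
    rw [this]
    linear_combination (N + 1 : ℝ) * tot'
  rw [mul_assoc]
  nth_rewrite 1 [← abs_of_pos hSpos]
  rw [← abs_mul, key]
  have b1 : d * |∑ k ∈ Finset.range (N+1), R k * ((N + 1 : ℝ) * f k - S)|
      ≤ K * ((N + 1) * (2 * N * E)) := by
    refine (mul_le_mul_of_nonneg_left (Finset.abs_sum_le_sum_abs _ _) hd.le).trans ?_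
    rw [hK, Finset.mul_sum, Finset.sum_mul]
    refine Finset.sum_le_sum fun j hj => ?_
    rw [abs_mul]
    have := mul_le_mul_of_nonneg_left (dev j (Finset.mem_range.1 hj)) (abs_nonneg (R j))
    linarith
  have b2 : d * |q * ((N + 1 : ℝ) * f N - S)| ≤ q * ((N + 1) * (2 * N * E)) := by
    rw [abs_mul, abs_of_nonneg hq]
    have := mul_le_mul_of_nonneg_left (dev N (by omega)) hq
    linarith
  have b3 := mul_le_mul_of_nonneg_left (abs_sub (∑ k ∈ Finset.range (N+1), R k * ((N + 1 : ℝ) * f k - S)) (q * ((N + 1 : ℝ) * f N - S))) hd.le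
  have e : (K + q) * ((N + 1) * (2 * N * (2 * K + 2 * q))) * S
     = K * ((N + 1) * (2 * N * E)) + q * ((N + 1) * (2 * N * E)) := by rw [hE]; ring
  rw [e]
  linarith

def extZ {n : ℕ} (φ : Fin n → ℝ) (k : ℕ) : ℝ := if h : k < n then φ ⟨k, h⟩ else 0

lemma extZ_fin {n : ℕ} (φ : Fin n → ℝ) (i : Fin n) : extZ φ i = φ i := by
  simp [extZ]

/-- in case (a), `λ₁(d,q,r) → max_i r_i - q` as `d → 0` and
`λ₁(d,q,r) → (∑ i, r i - q)/n` as `d → ∞`. -/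
theorem stmt_2 (n : ℕ) (hn : 2 ≤ n) (q : ℝ) (hq : 0 ≤ q) (r : Fin n → ℝ)
    (m : ℝ) (hm : IsGreatest (Set.range r) m) :
    (∀ ε : ℝ, 0 < ε → ∃ δ : ℝ, 0 < δ ∧ ∀ d : ℝ, 0 < d → d < δ →
      ∀ (lam : ℝ) (φ : Fin n → ℝ), (∀ i, 0 < φ i) →
        (d • Da n + q • Qm n + Matrix.diagonal r).mulVec φ = lam • φ →
        |lam - (m - q)| < ε) ∧
    (∀ ε : ℝ, 0 < ε → ∃ M : ℝ, 0 < M ∧ ∀ d : ℝ, M < d →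
      ∀ (lam : ℝ) (φ : Fin n → ℝ), (∀ i, 0 < φ i) →
        (d • Da n + q • Qm n + Matrix.diagonal r).mulVec φ = lam • φ →
        |lam - ((∑ i, r i - q) / (n : ℝ))| < ε) := by
  obtain ⟨N, rfl⟩ : ∃ N, n = N + 1 := ⟨n - 1, by omega⟩
  have hN : 1 ≤ N := by omega
  have hRm : ∀ k < N + 1, extZ r k ≤ m := fun k hk => by
    have := extZ_fin r ⟨k, hk⟩
    simp only at this
    rw [this]
    exact hm.2 ⟨_, rfl⟩
  have hpos : ∀ φ : Fin (N+1) → ℝ, (∀ i, 0 < φ i) → ∀ k < N + 1, 0 < extZ φ k :=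
    fun φ h k hk => by simp only [extZ, hk, dif_pos]; exact h _
  have hz : ∀ φ : Fin (N+1) → ℝ, extZ φ (N+1) = 0 := fun φ => by simp [extZ]
  constructor
  · intro ε hε
    set s : ℝ := min 1 (ε / (4 * (q + 1))) with hs
    have hs0 : 0 < s := by positivity
    have hs1 : s ≤ 1 := min_le_left _ _
    have hqs : q * s ≤ ε / 4 := by
      have h1 : s ≤ ε / (4 * (q + 1)) := min_le_right _ _
      rw [le_div_iff₀ (by positivity)] at h1
      nlinarith
    refine ⟨ε / 4 * s, by positivity, fun d hd hd' lam φ hφ h => ?_⟩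
    obtain ⟨⟨p, hp⟩, hpm⟩ := hm.1
    have hrow := rowEq N hN d q lam r φ (extZ φ) (extZ r) (extZ_fin φ) (extZ_fin r) (hz φ) h
    obtain ⟨h1, h2⟩ := part1 N d q lam m s hq hd hs0 (extZ φ) (extZ r) (hpos φ hφ) (hz φ) hRm p hp
      (by rw [← hpm]; exact extZ_fin r ⟨p, hp⟩) hrow
    have h3 : d / s < ε / 4 := by rwa [div_lt_iff₀ hs0]
    have h4 : d < ε / 4 := by nlinarith
    have h5 : d * s ≤ d := by nlinarith
    rw [abs_lt]
    constructor <;> linarith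
  · intro ε hε
    set K := ∑ k ∈ Finset.range (N+1), |extZ r k| with hK
    have hK0 : 0 ≤ K := Finset.sum_nonneg fun _ _ => abs_nonneg _
    set C := (K + q) * ((N + 1) * (2 * N * (2 * K + 2 * q))) with hC
    have hC0 : 0 ≤ C := by positivity
    refine ⟨C / ε + 1, by positivity, fun d hd lam φ hφ h => ?_⟩
    have hd0 : 0 < d := lt_of_le_of_lt (by positivity) hd
    have hrow := rowEq N hN d q lam r φ (extZ φ) (extZ r) (extZ_fin φ) (extZ_fin r) (hz φ) h
    have h1 := part2 N hN d q lam K hq hd0 (extZ φ) (extZ r) (hpos φ hφ) (hz φ) hK hrow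
    have hsum : ∑ k ∈ Finset.range (N+1), extZ r k = ∑ i, r i := by
      rw [← Fin.sum_univ_eq_sum_range]
      exact Finset.sum_congr rfl fun i _ => extZ_fin r i
    rw [hsum, ← hC] at h1
    have hN0 : (0:ℝ) < N + 1 := by positivity
    have h2 : lam - (∑ i, r i - q) / ((N + 1 : ℕ) : ℝ)
        = (lam * (N + 1 : ℝ) - (∑ i, r i - q)) / (N + 1) := by
      push_cast; field_simp
    rw [h2, abs_div, abs_of_pos hN0]
    set X := |lam * (N + 1 : ℝ) - (∑ i, r i - q)| with hX
    have hX0 : 0 ≤ X := abs_nonneg _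
    have h3 : X / (N + 1) ≤ X := div_le_self hX0 (by linarith [(Nat.cast_nonneg N : (0:ℝ) ≤ N)])
    refine h3.trans_lt ?_
    have h4 : C < d * ε := by
      have : C / ε < d := by linarith
      rwa [div_lt_iff₀ hε] at this
    exact lt_of_mul_lt_mul_left (h1.trans_lt h4) hd0.le
end

section
/- Fix q ≥ 0 and r ∈ ℝⁿ, and consider case (b). (i) For every ε > 0 there exists δ > 0 such that for every d ∈ (0,δ): if λ ∈ ℝ and φ ≫ 0 satisfy (dD + qQ + diag(r))φ = λφ, then |λ − (max_{1≤i≤n} r_i − q)| < ε. (ii) For every M ∈ ℝ there exists d₀ > 0 such that for every d > d₀: if λ ∈ ℝ and φ ≫ 0 satisfy (dD + qQ + diag(r))φ = λφ, then λ < M. (That is, λ₁(d,q,r) → max_i r_i − q as d → 0 and λ₁(d,q,r) → −∞ as d → ∞.) -/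
open Matrix Filter

lemma aux_entry_s4 (n : ℕ) (d q : ℝ) (r : Fin n → ℝ) (i j : Fin n) :
    (d • Db n + q • Qm n + Matrix.diagonal r) i j =
      (if (j:ℕ) = (i:ℕ) then (if (i:ℕ) = 0 then -d else -2*d) - q + r i else 0)
      + (if (j:ℕ) = (i:ℕ) + 1 then d else 0)
      + (if (j:ℕ) + 1 = (i:ℕ) then d + q else 0) := by
  simp only [Matrix.add_apply, Matrix.smul_apply, Db, Qm, Matrix.diagonal_apply, smul_eq_mul,
    Fin.ext_iff]
  split_ifs <;> first | omega | ring

lemma aux_row0 (n : ℕ) (d q : ℝ) (hd : 0 < d) (r : Fin n → ℝ) (f : ℕ → ℝ)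
    (hf : ∀ k, k ≤ n → 0 ≤ f k) (i : Fin n) (hi : (i:ℕ) = 0) :
    (d • Db n + q • Qm n + Matrix.diagonal r).mulVec (fun j => f j) i ≤
      d * (f 1 - f 0) - q * f 0 + r i * f 0 := by
  have hn : 0 < n := by have := i.2; omega
  have h1 := hf 1 hn
  simp only [Matrix.mulVec, dotProduct, aux_entry_s4, hi]
  rw [Fin.sum_univ_eq_sum_range (fun j => ((if j = 0 then (if True then -d else -2*d) - q + r i else 0)
      + (if j = 0 + 1 then d else 0) + (if j + 1 = 0 then d + q else 0)) * f j) n]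
  simp only [add_mul, ite_mul, zero_mul, Finset.sum_add_distrib, Finset.sum_ite_eq',
    Finset.mem_range]
  simp only [hn, if_true, Nat.succ_ne_zero, if_false, Finset.sum_const_zero, zero_add]
  have := mul_nonneg hd.le h1
  split_ifs <;> nlinarith

lemma aux_row1 (n : ℕ) (d q : ℝ) (hd : 0 < d) (r : Fin n → ℝ) (f : ℕ → ℝ)
    (hf : ∀ k, k ≤ n → 0 ≤ f k) (i : Fin n) (k : ℕ) (hi : (i:ℕ) = k + 1) :
    (d • Db n + q • Qm n + Matrix.diagonal r).mulVec (fun j => f j) i ≤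
      d * (f k + f (k+2) - 2 * f (k+1)) + q * (f k - f (k+1)) + r i * f (k+1) := by
  have hn : k + 1 < n := by have := i.2; omega
  have hn' : k < n := by omega
  have h1 := hf (k+2) hn
  simp only [Matrix.mulVec, dotProduct, aux_entry_s4, hi]
  rw [Fin.sum_univ_eq_sum_range (fun j => ((if j = k+1 then (if k+1 = 0 then -d else -2*d) - q + r i else 0)
      + (if j = k+1 + 1 then d else 0) + (if j + 1 = k+1 then d + q else 0)) * f j) n]
  simp only [add_mul, ite_mul, zero_mul, Finset.sum_add_distrib, Finset.sum_ite_eq',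
    Finset.mem_range, Nat.add_right_cancel_iff]
  simp only [hn, hn', if_true, Nat.succ_ne_zero, if_false]
  have := mul_nonneg hd.le h1
  split_ifs <;> nlinarith

lemma aux_off (n : ℕ) (d q : ℝ) (hd : 0 < d) (hq : 0 ≤ q) (r : Fin n → ℝ) (i j : Fin n)
    (hij : j ≠ i) : 0 ≤ (d • Db n + q • Qm n + Matrix.diagonal r) i j := by
  rw [aux_entry_s4]
  have : (j:ℕ) ≠ i := fun h => hij (Fin.ext h)
  simp only [this, if_false]
  split_ifs <;> linarith

lemma aux_cmp (n : ℕ) (A : Matrix (Fin n) (Fin n) ℝ) (hn : 0 < n)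
    (hA : ∀ i j, j ≠ i → 0 ≤ A i j) (φ ψ : Fin n → ℝ) (hφ : ∀ i, 0 < φ i) (hψ : ∀ i, 0 < ψ i)
    (lam μ : ℝ) (h : A.mulVec φ = lam • φ) (h' : ∀ i, A.mulVec ψ i ≤ μ * ψ i) : lam ≤ μ := by
  have : Nonempty (Fin n) := ⟨⟨0, hn⟩⟩
  obtain ⟨i, hi⟩ := Finite.exists_max (fun i => φ i / ψ i)
  set t := φ i / ψ i with ht
  have hti : φ i = t * ψ i := by rw [ht]; field_simp [(hψ i).ne']
  have htp : 0 < t := div_pos (hφ i) (hψ i)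
  have hle : ∀ j, φ j ≤ t * ψ j := fun j => (div_le_iff₀ (hψ j)).1 (hi j)
  have e := congrFun h i
  have key : A.mulVec φ i ≤ t * A.mulVec ψ i := by
    simp only [Matrix.mulVec, dotProduct, Finset.mul_sum]
    apply Finset.sum_le_sum
    intro j _
    by_cases hj : j = i
    · subst hj; rw [hti]; apply le_of_eq; ring
    · have := mul_le_mul_of_nonneg_left (hle j) (hA i j hj)
      linarith
  have h2 := mul_le_mul_of_nonneg_left (h' i) htp.le
  simp only [Pi.smul_apply, smul_eq_mul] at e
  have : lam * φ i ≤ μ * φ i := by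
    rw [← e]; calc _ ≤ _ := key
      _ ≤ _ := h2
      _ = _ := by rw [hti]; ring
  exact le_of_mul_le_mul_right this (hφ i)

/-- in case (b), `λ₁(d,q,r) → max_i r_i - q` as `d → 0` and
`λ₁(d,q,r) → -∞` as `d → ∞`. -/
theorem stmt_4 (n : ℕ) (hn : 2 ≤ n) (q : ℝ) (hq : 0 ≤ q) (r : Fin n → ℝ)
    (m : ℝ) (hm : IsGreatest (Set.range r) m) :
    (∀ ε : ℝ, 0 < ε → ∃ δ : ℝ, 0 < δ ∧ ∀ d : ℝ, 0 < d → d < δ →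
      ∀ (lam : ℝ) (φ : Fin n → ℝ), (∀ i, 0 < φ i) →
        (d • Db n + q • Qm n + Matrix.diagonal r).mulVec φ = lam • φ →
        |lam - (m - q)| < ε) ∧
    (∀ M : ℝ, ∃ d₀ : ℝ, 0 < d₀ ∧ ∀ d : ℝ, d₀ < d →
      ∀ (lam : ℝ) (φ : Fin n → ℝ), (∀ i, 0 < φ i) →
        (d • Db n + q • Qm n + Matrix.diagonal r).mulVec φ = lam • φ →
        lam < M) := by
  have hr : ∀ i, r i ≤ m := fun i => hm.2 ⟨i, rfl⟩
  obtain ⟨i0, hi0⟩ := hm.1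
  have hn0 : 0 < n := by omega
  constructor
  · intro ε hε
    set K : ℝ := 1 + 2 * q / ε with hK
    have hKq : q ≤ ε / 2 * K := by
      have : ε / 2 * K = ε / 2 + q := by rw [hK]; field_simp
      linarith
    have hK1 : 1 ≤ K := by
      have : 0 ≤ 2 * q / ε := by positivity
      linarith
    have hK0 : 0 < K := by linarith
    refine ⟨ε / (4 * K), by positivity, ?_⟩
    intro d hd hdδ lam φ hφ h
    have hdK : d * (4 * K) < ε := (lt_div_iff₀ (by positivity)).1 hdδ
    have hdK1 : d ≤ d * K := by nlinarith
    have up : lam ≤ m - q + ε / 2 + 2 * (d * K) := by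
      refine aux_cmp n _ hn0 (aux_off n d q hd hq r) φ (fun j => K ^ (j:ℕ)) hφ
        (fun i => by positivity) lam _ h ?_
      intro i
      have hri := hr i
      rcases hk : (i:ℕ) with _ | k
      · refine (aux_row0 n d q hd r (fun j => K ^ j) (fun k _ => by positivity) i hk).trans ?_
        simp only [pow_zero, pow_one]
        nlinarith
      · refine (aux_row1 n d q hd r (fun j => K ^ j) (fun k _ => by positivity) i k hk).trans ?_
        simp only [pow_succ]
        have hp : 0 < K ^ k := by positivity
        generalize K ^ k = p at hp
        have a1 : q * p ≤ (ε / 2 * K) * p := mul_le_mul_of_nonneg_right hKq hp.le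
        have a2 : r i * (p * K) ≤ m * (p * K) := mul_le_mul_of_nonneg_right hri (by positivity)
        have a3 : d * p ≤ d * K * (p * K) := by
          have : p ≤ p * K := by nlinarith
          exact mul_le_mul hdK1 this hp.le (by positivity)
        have a4 : 0 ≤ d * (p * K) := by positivity
        nlinarith
    have low : m - q - 2 * d ≤ lam := by
      have e := congrFun h i0
      simp only [Pi.smul_apply, smul_eq_mul] at e
      have s : (d • Db n + q • Qm n + Matrix.diagonal r) i0 i0 * φ i0 ≤ lam * φ i0 := by
        rw [← e, Matrix.mulVec, dotProduct, ← Finset.add_sum_erase _ _ (Finset.mem_univ i0)]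
        refine le_add_of_nonneg_right (Finset.sum_nonneg fun j hj => ?_)
        exact mul_nonneg (aux_off n d q hd hq r i0 j (Finset.ne_of_mem_erase hj)) (hφ j).le
      have s2 := le_of_mul_le_mul_right s (hφ i0)
      rw [aux_entry_s4] at s2
      simp only [if_true, hi0] at s2
      have c1 : ¬ ((i0:ℕ) = (i0:ℕ) + 1) := by omega
      have c2 : ¬ ((i0:ℕ) + 1 = (i0:ℕ)) := by omega
      rw [if_neg c1, if_neg c2] at s2
      split_ifs at s2 <;> linarith
    rw [abs_lt]
    constructor <;> linarith
  · intro M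
    have hN : (0:ℝ) < n := by exact_mod_cast hn0
    set N : ℝ := (n : ℝ) with hNdef
    refine ⟨(|m + q * (2 * N) - M| + 1) * N ^ 2, by positivity, ?_⟩
    intro d hdd lam φ hφ h
    have hd : 0 < d := lt_trans (by positivity) hdd
    have hc : |m + q * (2 * N) - M| + 1 < d / N ^ 2 := (lt_div_iff₀ (by positivity)).2 hdd
    set c := d / N ^ 2 with hcdef
    have hdc : d = c * N ^ 2 := by rw [hcdef]; field_simp
    have hc0 : 0 < c := by positivity
    have hfn : ∀ k : ℕ, k ≤ n → (0:ℝ) ≤ N ^ 2 - (k:ℝ) ^ 2 := by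
      intro k hk
      have : (k:ℝ) ≤ N := by rw [hNdef]; exact_mod_cast hk
      have h0 : (0:ℝ) ≤ k := Nat.cast_nonneg k
      nlinarith
    have up : lam ≤ m + q * (2 * N) - c := by
      refine aux_cmp n _ hn0 (aux_off n d q hd hq r) φ (fun j => N ^ 2 - ((j:ℕ):ℝ) ^ 2) hφ
        ?_ lam _ h ?_
      · intro i
        have : ((i:ℕ):ℝ) + 1 ≤ N := by rw [hNdef]; exact_mod_cast i.2
        have h0 : (0:ℝ) ≤ ((i:ℕ):ℝ) := Nat.cast_nonneg _
        nlinarith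
      intro i
      have hri := hr i
      rcases hk : (i:ℕ) with _ | k
      · refine (aux_row0 n d q hd r (fun j => N ^ 2 - (j:ℝ) ^ 2) hfn i hk).trans ?_
        simp only [Nat.cast_zero, Nat.cast_one]
        have a1 : r i * N ^ 2 ≤ m * N ^ 2 := mul_le_mul_of_nonneg_right hri (by positivity)
        have a2 : 0 ≤ q * (2 * N) * N ^ 2 := by positivity
        have a3 : 0 ≤ q * N ^ 2 := by positivity
        nlinarith
      · refine (aux_row1 n d q hd r (fun j => N ^ 2 - (j:ℝ) ^ 2) hfn i k hk).trans ?_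
        have hkN : (k:ℝ) + 1 + 1 ≤ N := by
          have := i.2
          rw [hk] at this
          rw [hNdef]; exact_mod_cast this

        push_cast
        have h0 : (0:ℝ) ≤ (k:ℝ) := Nat.cast_nonneg _
        generalize (k:ℝ) = x at hkN h0
        obtain ⟨y, hy⟩ : ∃ y, y = N ^ 2 - (x + 1) ^ 2 := ⟨_, rfl⟩
        have hy1 : 1 ≤ y := by rw [hy]; nlinarith
        have hy2 : y ≤ N ^ 2 := by rw [hy]; nlinarith
        rw [← hy]
        have a1 : r i * y ≤ m * y := mul_le_mul_of_nonneg_right hri (by linarith)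
        have a2 : q * (N ^ 2 - x ^ 2 - y) ≤ q * (2 * N * y) := by
          apply mul_le_mul_of_nonneg_left _ hq
          rw [show N ^ 2 - x ^ 2 - y = 2 * x + 1 by rw [hy]; ring]
          nlinarith
        have a3 : d * (N ^ 2 - x ^ 2 + (N ^ 2 - (x + 2) ^ 2) - 2 * y) = - 2 * d := by
          rw [hy]; ring
        have a4 : c * y ≤ d := by rw [hdc]; exact mul_le_mul_of_nonneg_left hy2 hc0.le
        rw [a3]
        nlinarith
    have := le_abs_self (m + q * (2 * N) - M)
    linarith
end

section
/- Consider case (a). Let r ∈ ℝⁿ satisfy Σ_{i=1}^n r_i > 0 and fix d > 0. Then there exists a unique q* > 0 such that dD + q*Q + diag(r) has eigenvalue 0 with a positive eigenvector. Moreover: for every q with 0 ≤ q < q*, every λ ∈ ℝ admitting φ ≫ 0 with (dD + qQ + diag(r))φ = λφ satisfies λ > 0; and for every q > q*, every λ ∈ ℝ admitting φ ≫ 0 with (dD + qQ + diag(r))φ = λφ satisfies λ < 0. -/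
open Matrix Filter

def Adj5 (n : ℕ) : Matrix (Fin n) (Fin n) ℝ := fun i j =>
  if (i : ℕ) + 1 = (j : ℕ) ∨ (j : ℕ) + 1 = (i : ℕ) then 1 else 0

def Sm5 (n : ℕ) (r : Fin n → ℝ) (d s : ℝ) : Matrix (Fin n) (Fin n) ℝ :=
  d • Da n + (d * (s - 1)) • Adj5 n + Matrix.diagonal (fun i => r i - d * (s ^ 2 - 1))

lemma Da_symm5 (n : ℕ) (i j : Fin n) : Da n i j = Da n j i := by
  unfold Da
  by_cases h : i = j
  · subst h; rfl
  · have h' : ¬ j = i := fun e => h e.symm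
    simp only [h, h', if_false, or_comm]

lemma Adj_symm5 (n : ℕ) (i j : Fin n) : Adj5 n i j = Adj5 n j i := by
  unfold Adj5
  simp only [or_comm]

lemma Sm_symm5 (n : ℕ) (r : Fin n → ℝ) (d s : ℝ) (i j : Fin n) :
    Sm5 n r d s i j = Sm5 n r d s j i := by
  simp only [Sm5, Matrix.add_apply, Matrix.smul_apply, Da_symm5 n i j, Adj_symm5 n i j,
    Matrix.diagonal_apply]
  by_cases h : i = j
  · subst h; rfl
  · have h' : ¬ j = i := fun e => h e.symm
    simp [h, h']

lemma Da_off5 (n : ℕ) (i j : Fin n) (h : i ≠ j) : Da n i j = Adj5 n i j := by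
  unfold Da Adj5
  simp [h]

lemma Adj_nonneg5 (n : ℕ) (i j : Fin n) : 0 ≤ Adj5 n i j := by
  unfold Adj5; split_ifs <;> norm_num

lemma Adj_diag5 (n : ℕ) (i : Fin n) : Adj5 n i i = 0 := by
  unfold Adj5; simp

lemma Sm_off5 (n : ℕ) (r : Fin n → ℝ) (d s : ℝ) (i j : Fin n) (h : i ≠ j) :
    Sm5 n r d s i j = d * s * Adj5 n i j := by
  simp only [Sm5, Matrix.add_apply, Matrix.smul_apply, Da_off5 n i j h,
    Matrix.diagonal_apply_ne _ h, smul_eq_mul]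
  ring

lemma Da_row5 (n : ℕ) (hn : 2 ≤ n) (i : Fin n) : ∑ j, Da n i j = 0 := by
  have e : ∀ j, Da n i j = (if (i : ℕ) + 1 = (j : ℕ) then (1:ℝ) else 0)
      + (if (j : ℕ) + 1 = (i : ℕ) then (1:ℝ) else 0)
      + (if i = j then (if (i : ℕ) = 0 ∨ (i : ℕ) = n - 1 then (-1:ℝ) else -2) else 0) := by
    intro j
    unfold Da
    by_cases h1 : (i : ℕ) + 1 = (j : ℕ)
    · have h2 : ¬ (j : ℕ) + 1 = (i : ℕ) := by omega
      have h3 : ¬ i = j := by intro h; rw [h] at h1; omega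
      simp [h1, h2, h3]
    · by_cases h2 : (j : ℕ) + 1 = (i : ℕ)
      · have h3 : ¬ i = j := by intro h; rw [h] at h2; omega
        simp [h1, h2, h3]
      · simp [h1, h2]
  have e1 : ∑ j : Fin n, (if (i : ℕ) + 1 = (j : ℕ) then (1:ℝ) else 0)
      = if (i : ℕ) = n - 1 then 0 else 1 := by
    split_ifs with h
    · apply Finset.sum_eq_zero
      intro j _
      have := j.2
      rw [if_neg]; omega
    · have hi := i.2
      rw [Finset.sum_eq_single (⟨i + 1, by omega⟩ : Fin n)]
      · simp
      · intro j _ hj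
        rw [if_neg]
        intro h; apply hj; ext; simp [h]
      · simp
  have e2 : ∑ j : Fin n, (if (j : ℕ) + 1 = (i : ℕ) then (1:ℝ) else 0)
      = if (i : ℕ) = 0 then 0 else 1 := by
    split_ifs with h
    · apply Finset.sum_eq_zero
      intro j _
      rw [if_neg]; omega
    · have hi := i.2
      rw [Finset.sum_eq_single (⟨i - 1, by omega⟩ : Fin n)]
      · rw [if_pos]; simp; omega
      · intro j _ hj
        rw [if_neg]
        intro h; apply hj; ext; simp; omega
      · simp
  simp only [e, Finset.sum_add_distrib, e1, e2, Finset.sum_ite_eq, Finset.mem_univ, if_true]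
  by_cases h1 : (i : ℕ) = 0
  · have h2 : ¬ (i : ℕ) = n - 1 := by omega
    rw [if_neg h2, if_pos h1, if_pos (Or.inl h1)]; norm_num
  · by_cases h2 : (i : ℕ) = n - 1
    · rw [if_pos h2, if_neg h1, if_pos (Or.inr h2)]; norm_num
    · rw [if_neg h2, if_neg h1, if_neg (by tauto)]; norm_num

lemma picone5 {n : ℕ} (S : Matrix (Fin n) (Fin n) ℝ) (hs : ∀ i j, S i j = S j i)
    (ho : ∀ i j, i ≠ j → 0 ≤ S i j) (lam : ℝ) (η : Fin n → ℝ) (hη : ∀ i, 0 < η i)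
    (he : ∀ i, ∑ j, S i j * η j = lam * η i) (ξ : Fin n → ℝ) :
    ∑ i, ∑ j, S i j * ξ i * ξ j ≤ lam * ∑ i, ξ i ^ 2 := by
  have h1 : ∑ i, ∑ j, S i j * ξ i * ξ j ≤
      ∑ i, ∑ j, (S i j * (ξ i ^ 2 / η i * η j) / 2 + S i j * (ξ j ^ 2 / η j * η i) / 2) := by
    apply Finset.sum_le_sum; intro i _
    apply Finset.sum_le_sum; intro j _
    by_cases h : i = j
    · subst h
      have := (hη i).ne'
      apply le_of_eq; field_simp; ring
    · have h0 := ho i j h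
      have hi := hη i
      have hj := hη j
      have : ξ i * ξ j ≤ (ξ i ^ 2 / η i * η j + ξ j ^ 2 / η j * η i) / 2 := by
        have : (ξ i ^ 2 / η i * η j + ξ j ^ 2 / η j * η i) / 2 - ξ i * ξ j
            = (ξ i * η j - ξ j * η i) ^ 2 / (2 * η i * η j) := by
          field_simp; ring
        have h2 : 0 ≤ (ξ i * η j - ξ j * η i) ^ 2 / (2 * η i * η j) := by positivity
        linarith
      nlinarith [mul_le_mul_of_nonneg_left this h0]
  have h2 : ∀ i, ∑ j, S i j * (ξ i ^ 2 / η i * η j) / 2 = lam * ξ i ^ 2 / 2 := by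
    intro i
    have : ∑ j, S i j * (ξ i ^ 2 / η i * η j) / 2
        = (ξ i ^ 2 / η i) / 2 * ∑ j, S i j * η j := by
      rw [Finset.mul_sum]; apply Finset.sum_congr rfl; intro j _; ring
    rw [this, he]
    have := (hη i).ne'
    field_simp
  have h3 : ∑ i, ∑ j, S i j * (ξ j ^ 2 / η j * η i) / 2 = ∑ i, lam * ξ i ^ 2 / 2 := by
    rw [Finset.sum_comm]
    apply Finset.sum_congr rfl; intro i _
    rw [← h2 i]
    apply Finset.sum_congr rfl; intro j _
    rw [hs i j]
  refine h1.trans (le_of_eq ?_)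
  simp only [Finset.sum_add_distrib, h3, h2]
  rw [← Finset.sum_add_distrib, Finset.mul_sum]
  apply Finset.sum_congr rfl; intro i _; ring

def P5 (n : ℕ) (ξ : Fin n → ℝ) : ℝ := ∑ i, ∑ j, Adj5 n i j * ξ i * ξ j
def E5 (n : ℕ) (ξ : Fin n → ℝ) : ℝ := ∑ i, ∑ j, Da n i j * ξ i * ξ j
def F5 (n : ℕ) (r : Fin n → ℝ) (d s : ℝ) (ξ : Fin n → ℝ) : ℝ :=
  ∑ i, ∑ j, Sm5 n r d s i j * ξ i * ξ j

lemma E5_le (n : ℕ) (hn : 2 ≤ n) (ξ : Fin n → ℝ) : E5 n ξ ≤ 0 := by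
  have := picone5 (Da n) (Da_symm5 n) (fun i j h => by
    rw [Da_off5 n i j h]; exact Adj_nonneg5 n i j) 0 (fun _ => 1) (fun _ => one_pos)
    (fun i => by simp [Da_row5 n hn i]) ξ
  simpa [E5] using this

lemma P5_le (n : ℕ) (hn : 2 ≤ n) (ξ : Fin n → ℝ) : P5 n ξ ≤ 2 * ∑ i, ξ i ^ 2 := by
  have h := E5_le n hn ξ
  have : P5 n ξ ≤ E5 n ξ + 2 * ∑ i, ξ i ^ 2 := by
    have e : E5 n ξ + 2 * ∑ i, ξ i ^ 2
        = ∑ i, ∑ j, (Da n i j * ξ i * ξ j + if i = j then 2 * ξ i ^ 2 else 0) := by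
      simp [E5, Finset.sum_add_distrib, Finset.mul_sum]
    rw [e, P5]
    apply Finset.sum_le_sum; intro i _
    apply Finset.sum_le_sum; intro j _
    by_cases h : i = j
    · subst h
      rw [Adj_diag5]
      have : -2 ≤ Da n i i := by unfold Da; split_ifs <;> norm_num
      simp; nlinarith [sq_nonneg (ξ i)]
    · rw [Da_off5 n i j h]; simp [h]
  linarith

lemma F5_eq (n : ℕ) (r : Fin n → ℝ) (d s : ℝ) (ξ : Fin n → ℝ) :
    F5 n r d s ξ = d * E5 n ξ + d * (s - 1) * P5 n ξ + ∑ i, r i * ξ i ^ 2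
      - d * (s ^ 2 - 1) * ∑ i, ξ i ^ 2 := by
  have : ∀ i, ∑ j, Sm5 n r d s i j * ξ i * ξ j
      = d * (∑ j, Da n i j * ξ i * ξ j) + d * (s - 1) * (∑ j, Adj5 n i j * ξ i * ξ j)
        + (r i * ξ i ^ 2 - d * (s ^ 2 - 1) * ξ i ^ 2) := by
    intro i
    have e : (r i * ξ i ^ 2 - d * (s ^ 2 - 1) * ξ i ^ 2)
      = ∑ j, if i = j then (r i - d * (s ^ 2 - 1)) * ξ i * ξ j else 0 := by
      simp; ring
    rw [e, Finset.mul_sum, Finset.mul_sum, ← Finset.sum_add_distrib, ← Finset.sum_add_distrib]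
    apply Finset.sum_congr rfl; intro j _
    simp only [Sm5, Matrix.add_apply, Matrix.smul_apply, Matrix.diagonal_apply, smul_eq_mul]
    split_ifs <;> ring
  simp only [F5, this, Finset.sum_add_distrib, Finset.sum_sub_distrib, ← Finset.mul_sum, E5, P5]
  ring

lemma F5_mono (n : ℕ) (hn : 2 ≤ n) (r : Fin n → ℝ) (d s t : ℝ) (hd : 0 < d) (hs : 1 ≤ s)
    (hst : s < t) (ξ : Fin n → ℝ) (hξ : 0 < ∑ i, ξ i ^ 2) : F5 n r d t ξ < F5 n r d s ξ := by
  rw [F5_eq, F5_eq]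
  have h := P5_le n hn ξ
  have h1 : 0 < d * (t - s) := mul_pos hd (by linarith)
  have h2 : P5 n ξ - (s + t) * ∑ i, ξ i ^ 2 < 0 := by nlinarith
  nlinarith [mul_neg_of_pos_of_neg h1 h2]

lemma F5_smul (n : ℕ) (r : Fin n → ℝ) (d s c : ℝ) (ξ : Fin n → ℝ) :
    F5 n r d s (c • ξ) = c ^ 2 * F5 n r d s ξ := by
  simp only [F5, Finset.mul_sum, Pi.smul_apply, smul_eq_mul]
  apply Finset.sum_congr rfl; intro i _
  apply Finset.sum_congr rfl; intro j _
  ring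

lemma F5_cont (n : ℕ) (r : Fin n → ℝ) (d : ℝ) :
    Continuous (fun p : ℝ × (Fin n → ℝ) => F5 n r d p.1 p.2) := by
  simp only [F5, Sm5, Matrix.add_apply, Matrix.smul_apply, Matrix.diagonal_apply, smul_eq_mul]
  refine continuous_finsetSum _ fun i _ => continuous_finsetSum _ fun j _ => ?_
  split_ifs <;> fun_prop

lemma F5_abs (n : ℕ) (r : Fin n → ℝ) (d s : ℝ) (hd : 0 < d) (hs : 1 ≤ s) (ξ : Fin n → ℝ) :
    F5 n r d s ξ ≤ F5 n r d s (fun i => |ξ i|) := by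
  apply Finset.sum_le_sum; intro i _
  apply Finset.sum_le_sum; intro j _
  by_cases h : i = j
  · subst h
    rw [mul_assoc, mul_assoc, abs_mul_abs_self]
  · rw [mul_assoc, mul_assoc]
    apply mul_le_mul_of_nonneg_left
    · rw [← abs_mul]; exact le_abs_self _
    · rw [Sm_off5 n r d s i j h]
      have := Adj_nonneg5 n i j
      positivity

lemma conj5 (n : ℕ) (hn : 2 ≤ n) (r : Fin n → ℝ) (d s : ℝ) (η : Fin n → ℝ) (i : Fin n) :
    (d • Da n + (d * (s ^ 2 - 1)) • Qm n + Matrix.diagonal r).mulVec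
      (fun i => s ^ (i : ℕ) * η i) i = s ^ (i : ℕ) * ∑ j, Sm5 n r d s i j * η j := by
  rw [Matrix.mulVec, dotProduct, Finset.mul_sum]
  apply Finset.sum_congr rfl; intro j _
  by_cases h : i = j
  · subst h
    simp [Sm5, Adj5, Qm]
    ring
  · rw [Sm_off5 n r d s i j h]
    simp only [Matrix.add_apply, Matrix.smul_apply, Da_off5 n i j h,
      Matrix.diagonal_apply_ne _ h, smul_eq_mul, Adj5, Qm]
    by_cases h1 : (i : ℕ) + 1 = (j : ℕ)
    · have h2 : ¬ (j : ℕ) + 1 = (i : ℕ) := by omega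
      simp only [h1, h2, h, if_true, if_false, true_or]
      rw [← h1]; ring
    · by_cases h2 : (j : ℕ) + 1 = (i : ℕ)
      · simp only [h1, h2, if_true, if_false, or_true]
        rw [← h2]; ring
      · simp [h1, h2, h]

lemma F5_right (n : ℕ) (r : Fin n → ℝ) (d s : ℝ) (ξ : Fin n → ℝ) (h : 0 < F5 n r d s ξ) :
    ∃ t : ℝ, s < t ∧ 0 < F5 n r d t ξ := by
  have hc : Continuous fun t : ℝ => F5 n r d t ξ := by
    have := (F5_cont n r d).comp (Continuous.prodMk_left ξ)
    exact this
  have h1 : ∀ᶠ t in nhdsWithin s (Set.Ioi s), 0 < F5 n r d t ξ :=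
    (hc.continuousAt.eventually (lt_mem_nhds h)).filter_mono nhdsWithin_le_nhds
  obtain ⟨t, h, h'⟩ := (h1.and self_mem_nhdsWithin).exists
  exact ⟨t, h', h⟩

lemma exists5 (n : ℕ) (hn : 2 ≤ n) (r : Fin n → ℝ) (hr : 0 < ∑ i, r i)
    (d : ℝ) (hd : 0 < d) : ∃ s : ℝ, 1 < s ∧ (∀ ξ, F5 n r d s ξ ≤ 0) ∧
      ∃ η : Fin n → ℝ, (∀ i, 0 ≤ η i) ∧ (∑ i, η i ^ 2 = 1) ∧ F5 n r d s η = 0 := by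
  set R := ∑ i, |r i| with hR
  have hR0 : 0 ≤ R := Finset.sum_nonneg fun i _ => abs_nonneg _
  have hcN : Continuous fun p : ℝ × (Fin n → ℝ) => ∑ i, p.2 i ^ 2 := by fun_prop
  let K : Set (ℝ × (Fin n → ℝ)) := (Set.Icc 1 (2 + R / d) ×ˢ Set.Icc (fun _ => -1) (fun _ => 1)) ∩
    ({p | ∑ i, p.2 i ^ 2 = 1} ∩ {p | 0 ≤ F5 n r d p.1 p.2})
  have hK : IsCompact K := by
    apply (isCompact_Icc.prod isCompact_Icc).inter_right
    exact (isClosed_eq hcN continuous_const).inter (isClosed_le continuous_const (F5_cont n r d))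
  have key : ∀ s ξ, 1 ≤ s → ∑ i, ξ i ^ 2 = 1 → 0 ≤ F5 n r d s ξ → (s, ξ) ∈ K := by
    intro s ξ hs hξ hF
    have hsq : ∀ i, ξ i ^ 2 ≤ 1 := fun i => by
      rw [← hξ]
      exact Finset.single_le_sum (f := fun i => ξ i ^ 2) (fun j _ => sq_nonneg _) (Finset.mem_univ i)
    refine ⟨⟨⟨hs, ?_⟩, ?_, ?_⟩, hξ, hF⟩
    · show s ≤ 2 + R / d
      rw [F5_eq, hξ] at hF
      have h1 := E5_le n hn ξ
      have h2 := P5_le n hn ξ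
      rw [hξ] at h2
      have h3 : ∑ i, r i * ξ i ^ 2 ≤ R := by
        apply Finset.sum_le_sum; intro i _
        nlinarith [le_abs_self (r i), hsq i, sq_nonneg (ξ i), abs_nonneg (r i)]
      have h4 : d * (s - 1) * P5 n ξ ≤ d * (s - 1) * (2 * 1) :=
        mul_le_mul_of_nonneg_left h2 (mul_nonneg hd.le (by linarith))
      have h5 : d * E5 n ξ ≤ 0 := mul_nonpos_of_nonneg_of_nonpos hd.le h1
      have h6 : d * (s - 1) ^ 2 ≤ R := by nlinarith
      have h7 : (s - 1) ^ 2 ≤ R / d := by rw [le_div_iff₀ hd]; linarith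
      nlinarith [sq_nonneg (s - 1 - 1)]
    · intro i; have := hsq i; show -1 ≤ ξ i; nlinarith
    · intro i; have := hsq i; show ξ i ≤ 1; nlinarith
  have hn0 : (0:ℝ) < n := by exact_mod_cast (by omega : 0 < n)
  let o : Fin n → ℝ := (√n)⁻¹ • (fun _ => (1:ℝ))
  have hsqn : (√(n:ℝ))⁻¹ ^ 2 = (n:ℝ)⁻¹ := by rw [inv_pow, Real.sq_sqrt hn0.le]
  have ho : ∑ i, o i ^ 2 = 1 := by
    simp only [o, Pi.smul_apply, smul_eq_mul, mul_one, hsqn]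
    simp [hn0.ne']
  have hFo : 0 < F5 n r d 1 o := by
    rw [F5_smul, F5_eq, hsqn]
    have : E5 n (fun _ => 1) = 0 := by simp [E5, Da_row5 n hn]
    rw [this]
    simp only [one_pow, mul_one]
    have : 0 < (n:ℝ)⁻¹ := by positivity
    simp; positivity
  obtain ⟨s1, hs1, hF1⟩ : ∃ s1 : ℝ, 1 < s1 ∧ 0 < F5 n r d s1 o := F5_right n r d 1 o hFo
  obtain ⟨⟨s, ξ⟩, hmem, hmax⟩ := hK.exists_isMaxOn ⟨_, key s1 o hs1.le ho hF1.le⟩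
    continuous_fst.continuousOn
  have hs : 1 < s := lt_of_lt_of_le hs1 (hmax (key s1 o hs1.le ho hF1.le))
  have hneg : ∀ ξ, F5 n r d s ξ ≤ 0 := by
    intro ζ
    by_contra hcon
    push Not at hcon
    have hN : 0 < ∑ i, ζ i ^ 2 := by
      apply lt_of_le_of_ne (Finset.sum_nonneg fun i _ => sq_nonneg _)
      intro h0
      have hz := (Finset.sum_eq_zero_iff_of_nonneg (fun i _ => sq_nonneg (ζ i))).1 h0.symm
      have : ∀ i, ζ i = 0 := fun i => by simpa using hz i (Finset.mem_univ i)
      simp [F5, this] at hcon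
    obtain ⟨t, h', h⟩ := F5_right n r d s ζ hcon
    have hN2 : (√(∑ i, ζ i ^ 2))⁻¹ ^ 2 = (∑ i, ζ i ^ 2)⁻¹ := by
      rw [inv_pow, Real.sq_sqrt hN.le]
    have := hmax (key t ((√(∑ i, ζ i ^ 2))⁻¹ • ζ) (by linarith) (by
      simp only [Pi.smul_apply, smul_eq_mul, mul_pow, hN2]
      rw [← Finset.mul_sum, inv_mul_cancel₀ hN.ne']) (by rw [F5_smul]; positivity))
    have : t ≤ s := this
    linarith
  refine ⟨s, hs, hneg, fun i => |ξ i|, fun i => abs_nonneg _, ?_, ?_⟩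
  · simpa using hmem.2.1
  · apply le_antisymm (hneg _)
    exact le_trans hmem.2.2 (F5_abs n r d s hd hs.le ξ)

lemma null5 (n : ℕ) (r : Fin n → ℝ) (d s : ℝ) (hneg : ∀ ξ, F5 n r d s ξ ≤ 0)
    (η : Fin n → ℝ) (h0 : F5 n r d s η = 0) (i : Fin n) : ∑ j, Sm5 n r d s i j * η j = 0 := by
  have hF : ∀ ξ, ξ ⬝ᵥ (Sm5 n r d s).mulVec ξ = F5 n r d s ξ := by
    intro ξ
    simp only [dotProduct, Matrix.mulVec, F5, Finset.mul_sum]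
    apply Finset.sum_congr rfl; intro i _
    apply Finset.sum_congr rfl; intro j _
    ring
  have hps : (-(Sm5 n r d s)).PosSemidef := by
    apply Matrix.PosSemidef.of_dotProduct_mulVec_nonneg
    · ext i j
      simp [Sm_symm5 n r d s i j]
    · intro x
      simp only [star_trivial, Matrix.neg_mulVec, dotProduct_neg, hF]
      linarith [hneg x]
  have := (hps.dotProduct_mulVec_zero_iff η).1 (by
    simp only [star_trivial, Matrix.neg_mulVec, dotProduct_neg, hF, h0, neg_zero])
  have := congrFun this i
  simpa [Matrix.neg_mulVec, Matrix.mulVec, dotProduct] using this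

lemma pos5 (n : ℕ) (r : Fin n → ℝ) (d s : ℝ) (hd : 0 < d) (hs : 1 < s)
    (η : Fin n → ℝ) (hη : ∀ i, 0 ≤ η i) (h1 : ∑ i, η i ^ 2 = 1)
    (h0 : ∀ i, ∑ j, Sm5 n r d s i j * η j = 0) (i : Fin n) : 0 < η i := by
  by_contra hcon
  have hi : η i = 0 := le_antisymm (not_lt.1 hcon) (hη i)
  have hds : 0 < d * s := by positivity
  have step : ∀ i j : Fin n, η i = 0 → ((i : ℕ) + 1 = j ∨ (j : ℕ) + 1 = i) → η j = 0 := by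
    intro i j hi hij
    have hz := (Finset.sum_eq_zero_iff_of_nonneg (fun k _ => by
      by_cases h : i = k
      · rw [← h, hi, mul_zero]
      · rw [Sm_off5 n r d s i k h]
        exact mul_nonneg (mul_nonneg hds.le (Adj_nonneg5 n i k)) (hη k))).1 (h0 i) j
          (Finset.mem_univ j)
    have hne : i ≠ j := by rintro rfl; omega
    rw [Sm_off5 n r d s i j hne] at hz
    have : Adj5 n i j = 1 := by simp [Adj5, hij]
    rw [this] at hz
    simpa [hds.ne', hd.ne', (by linarith : s ≠ 0)] using hz
  have up : ∀ k (h : (i : ℕ) + k < n), η ⟨i + k, h⟩ = 0 := by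
    intro k
    induction k with
    | zero => intro h; exact hi
    | succ k ih => intro h; exact step _ _ (ih (by omega)) (Or.inl (by simp; omega))
  have down : ∀ k (h : k ≤ (i : ℕ)), η ⟨i - k, by omega⟩ = 0 := by
    intro k
    induction k with
    | zero => intro h; exact hi
    | succ k ih => intro h; exact step _ _ (ih (by omega)) (Or.inr (by simp; omega))
  have all : ∀ j, η j = 0 := by
    intro j
    rcases le_total (i : ℕ) j with h | h
    · have := up (j - i) (by omega)
      convert this using 2
      ext; simp; omega
    · have := down (i - j) (by omega)
      convert this using 2
      ext; simp; omega
  simp [all] at h1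

lemma trans5 (n : ℕ) (hn : 2 ≤ n) (r : Fin n → ℝ) (d s : ℝ) (hs : 1 ≤ s) (lam : ℝ)
    (φ : Fin n → ℝ) (hφ : ∀ i, 0 < φ i)
    (h : (d • Da n + (d * (s ^ 2 - 1)) • Qm n + Matrix.diagonal r).mulVec φ = lam • φ) :
    ∃ η : Fin n → ℝ, (∀ i, 0 < η i) ∧ ∀ i, ∑ j, Sm5 n r d s i j * η j = lam * η i := by
  have hp : ∀ i : ℕ, 0 < s ^ i := fun i => by positivity
  refine ⟨fun i => φ i / s ^ (i : ℕ), fun i => div_pos (hφ i) (hp _), fun i => ?_⟩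
  have h1 := conj5 n hn r d s (fun i => φ i / s ^ (i : ℕ)) i
  have e : (fun i : Fin n => s ^ (i : ℕ) * (φ i / s ^ (i : ℕ))) = φ := by
    funext i; have := (hp i).ne'; field_simp
  rw [e, h] at h1
  simp only [Pi.smul_apply, smul_eq_mul] at h1
  have h2 := (hp i).ne'
  rw [← mul_div_assoc, h1]; field_simp

lemma param5 (d q : ℝ) (hd : 0 < d) (hq : 0 ≤ q) : ∃ s : ℝ, 1 ≤ s ∧ q = d * (s ^ 2 - 1) := by
  refine ⟨√(1 + q / d), ?_, ?_⟩
  · rw [Real.one_le_sqrt]; have : 0 ≤ q / d := by positivity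
    linarith
  · rw [Real.sq_sqrt (by positivity)]; field_simp; ring

theorem stmt_5 (n : ℕ) (hn : 2 ≤ n) (r : Fin n → ℝ) (hr : 0 < ∑ i, r i)
    (d : ℝ) (hd : 0 < d) :
    ∃ qs : ℝ, 0 < qs ∧
      (∃ φ : Fin n → ℝ, (∀ i, 0 < φ i) ∧
        (d • Da n + qs • Qm n + Matrix.diagonal r).mulVec φ = 0) ∧
      (∀ q' : ℝ, 0 < q' →
        (∃ φ : Fin n → ℝ, (∀ i, 0 < φ i) ∧
          (d • Da n + q' • Qm n + Matrix.diagonal r).mulVec φ = 0) → q' = qs) ∧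
      (∀ q : ℝ, 0 ≤ q → q < qs →
        ∀ (lam : ℝ) (φ : Fin n → ℝ), (∀ i, 0 < φ i) →
          (d • Da n + q • Qm n + Matrix.diagonal r).mulVec φ = lam • φ → 0 < lam) ∧
      (∀ q : ℝ, qs < q →
        ∀ (lam : ℝ) (φ : Fin n → ℝ), (∀ i, 0 < φ i) →
          (d • Da n + q • Qm n + Matrix.diagonal r).mulVec φ = lam • φ → lam < 0) := by
  obtain ⟨s, hs, hneg, η, hη, hη1, hη0⟩ := exists5 n hn r hr d hd
  have hnull := null5 n r d s hneg η hη0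
  have hpos := pos5 n r d s hd hs η hη hη1 hnull
  have hqs : 0 < d * (s ^ 2 - 1) := mul_pos hd (by nlinarith)
  have A : ∀ q : ℝ, 0 ≤ q → q < d * (s ^ 2 - 1) →
        ∀ (lam : ℝ) (φ : Fin n → ℝ), (∀ i, 0 < φ i) →
          (d • Da n + q • Qm n + Matrix.diagonal r).mulVec φ = lam • φ → 0 < lam := by
    intro q hq hlt lam φ hφ he
    obtain ⟨t, ht, rfl⟩ := param5 d q hd hq
    have hts : t < s := by
      have := lt_of_mul_lt_mul_left hlt hd.le
      nlinarith
    obtain ⟨ζ, hζ, hζe⟩ := trans5 n hn r d t ht lam φ hφ he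
    have h1 := picone5 (Sm5 n r d t) (Sm_symm5 n r d t) (fun i j h => by
      rw [Sm_off5 n r d t i j h]
      have := Adj_nonneg5 n i j
      positivity) lam ζ hζ hζe η
    have h2 := F5_mono n hn r d t s hd ht hts η (by rw [hη1]; exact one_pos)
    rw [hη0] at h2
    rw [hη1, mul_one] at h1
    exact lt_of_lt_of_le h2 h1
  have B : ∀ q : ℝ, d * (s ^ 2 - 1) < q →
        ∀ (lam : ℝ) (φ : Fin n → ℝ), (∀ i, 0 < φ i) →
          (d • Da n + q • Qm n + Matrix.diagonal r).mulVec φ = lam • φ → lam < 0 := by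
    intro q hlt lam φ hφ he
    obtain ⟨t, ht, rfl⟩ := param5 d q hd (by linarith)
    have hts : s < t := by
      have := lt_of_mul_lt_mul_left hlt hd.le
      nlinarith
    obtain ⟨ζ, hζ, hζe⟩ := trans5 n hn r d t ht lam φ hφ he
    have hN : 0 < ∑ i, ζ i ^ 2 := by
      apply Finset.sum_pos (fun i _ => pow_pos (hζ i) 2)
      exact ⟨⟨0, by omega⟩, Finset.mem_univ _⟩
    have h2 := F5_mono n hn r d s t hd hs.le hts ζ hN
    have h3 : F5 n r d t ζ = lam * ∑ i, ζ i ^ 2 := by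
      rw [F5, Finset.mul_sum]
      apply Finset.sum_congr rfl; intro i _
      have : ∑ j, Sm5 n r d t i j * ζ i * ζ j = ζ i * ∑ j, Sm5 n r d t i j * ζ j := by
        rw [Finset.mul_sum]; apply Finset.sum_congr rfl; intro j _; ring
      rw [this, hζe]; ring
    have h4 := hneg ζ
    by_contra hc
    have := mul_nonneg (not_lt.1 hc) hN.le
    linarith
  refine ⟨d * (s ^ 2 - 1), hqs, ⟨fun i => s ^ (i : ℕ) * η i, fun i => ?_, ?_⟩, ?_, A, B⟩
  · exact mul_pos (by positivity) (hpos i)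
  · funext i
    rw [conj5 n hn, hnull, mul_zero]; rfl
  · rintro q' hq' ⟨φ, hφ, he⟩
    rcases lt_trichotomy q' (d * (s ^ 2 - 1)) with h | h | h
    · exact absurd (A q' hq'.le h 0 φ hφ (by rw [he, zero_smul])) (lt_irrefl _)
    · exact h
    · exact absurd (B q' h 0 φ hφ (by rw [he, zero_smul])) (lt_irrefl _)
end

section
/- Consider case (b). Let r ∈ ℝⁿ satisfy max_{1≤i≤n} r_i > 0. Then there exists a unique d* > 0 such that d*D + diag(r) has eigenvalue 0 with a positive eigenvector; moreover, for every d ∈ (0,d*), every λ ∈ ℝ admitting φ ≫ 0 with (dD + diag(r))φ = λφ satisfies λ > 0, and for every d > d*, every such λ satisfies λ < 0. Furthermore, for each d ∈ (0,d*) there exists q*(d) > 0 such that dD + q*(d)Q + diag(r) has eigenvalue 0 with a positive eigenvector, every real eigenvalue with a positive eigenvector of dD + qQ + diag(r) is positive for 0 ≤ q < q*(d), and negative for q > q*(d). -/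
open Matrix Filter

/-- adjacency matrix of the path -/
def Am (n : ℕ) : Matrix (Fin n) (Fin n) ℝ := fun i j =>
  if (i : ℕ) + 1 = (j : ℕ) ∨ (j : ℕ) + 1 = (i : ℕ) then 1 else 0

/-- diagonal of Db -/
def dl (n : ℕ) : Fin n → ℝ := fun i => if (i : ℕ) = 0 then -1 else -2

def qf {n : ℕ} (S : Matrix (Fin n) (Fin n) ℝ) (x : Fin n → ℝ) : ℝ := x ⬝ᵥ S.mulVec x

lemma qf_eq {n : ℕ} (S : Matrix (Fin n) (Fin n) ℝ) (x : Fin n → ℝ) :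
    qf S x = ∑ i, ∑ j, S i j * x i * x j := by
  simp only [qf, dotProduct, mulVec, Finset.mul_sum]
  exact Finset.sum_congr rfl fun i _ => Finset.sum_congr rfl fun j _ => by ring

lemma picone {n : ℕ} (S : Matrix (Fin n) (Fin n) ℝ) (hS : ∀ i j, S i j = S j i)
    (h0 : ∀ i j, i ≠ j → 0 ≤ S i j) (φ : Fin n → ℝ) (hφ : ∀ i, 0 < φ i) (x : Fin n → ℝ) :
    qf S x ≤ ∑ i, x i ^ 2 * (S.mulVec φ i / φ i) := by
  have h1 : ∑ i, x i ^ 2 * (S.mulVec φ i / φ i) = ∑ i, ∑ j, S i j * (φ j / φ i * x i ^ 2) := by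
    refine Finset.sum_congr rfl fun i _ => ?_
    simp only [mulVec, dotProduct, Finset.sum_div, Finset.mul_sum]
    exact Finset.sum_congr rfl fun j _ => by ring
  have h2 : ∑ i, ∑ j, S i j * (φ j / φ i * x i ^ 2)
      = ∑ i, ∑ j, S i j * (φ i / φ j * x j ^ 2) := by
    rw [Finset.sum_comm]
    exact Finset.sum_congr rfl fun j _ => Finset.sum_congr rfl fun i _ => by rw [hS i j]
  have h3 : qf S x ≤ ∑ i, ∑ j, (S i j * (φ j / φ i * x i ^ 2)
      + S i j * (φ i / φ j * x j ^ 2)) / 2 := by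
    rw [qf_eq]
    refine Finset.sum_le_sum fun i _ => Finset.sum_le_sum fun j _ => ?_
    by_cases hij : i = j
    · subst hij
      rw [div_self (hφ i).ne']
      apply le_of_eq; ring
    · have hp := h0 i j hij
      have hi := hφ i
      have hj := hφ j
      have : 2 * (x i * x j) ≤ φ j / φ i * x i ^ 2 + φ i / φ j * x j ^ 2 := by
        have e : φ j / φ i * x i ^ 2 + φ i / φ j * x j ^ 2 - 2 * (x i * x j)
            = (φ j * x i - φ i * x j) ^ 2 / (φ i * φ j) := by
          field_simp; ring
        have : 0 ≤ (φ j * x i - φ i * x j) ^ 2 / (φ i * φ j) := by positivity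
        linarith
      nlinarith [mul_le_mul_of_nonneg_left this hp]
  simp only [← Finset.sum_div, Finset.sum_add_distrib] at h3
  linarith

def sph (n : ℕ) : Set (Fin n → ℝ) := {x | x ⬝ᵥ x = 1}

lemma sph_compact (n : ℕ) : IsCompact (sph n) := by
  have hc : IsClosed (sph n) := by
    apply isClosed_eq <;> fun_prop
  refine (isCompact_univ_pi (fun _ : Fin n => isCompact_Icc (a := (-1 : ℝ)) (b := 1))).of_isClosed_subset hc ?_
  intro x hx i _
  have hx' : ∑ i, x i * x i = 1 := hx
  have := Finset.single_le_sum (f := fun i => x i * x i) (fun i _ => mul_self_nonneg _) (Finset.mem_univ i)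
  exact ⟨by nlinarith, by nlinarith⟩

noncomputable def mu {n : ℕ} (S : Matrix (Fin n) (Fin n) ℝ) : ℝ := sSup (qf S '' sph n)

lemma mu_cont (n : ℕ) : Continuous (mu : Matrix (Fin n) (Fin n) ℝ → ℝ) := by
  apply IsCompact.continuous_sSup (f := fun S x => qf S x) (sph_compact n)
  change Continuous fun p : Matrix (Fin n) (Fin n) ℝ × (Fin n → ℝ) => p.2 ⬝ᵥ p.1 *ᵥ p.2
  fun_prop

lemma qf_cont {n : ℕ} (S : Matrix (Fin n) (Fin n) ℝ) : Continuous (qf S) := by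
  unfold qf; fun_prop

lemma sph_ne {n : ℕ} (hn : 2 ≤ n) : (sph n).Nonempty :=
  ⟨Pi.single ⟨0, by omega⟩ 1, by simp [sph]⟩

lemma mu_att {n : ℕ} (hn : 2 ≤ n) (S : Matrix (Fin n) (Fin n) ℝ) :
    ∃ x, x ⬝ᵥ x = 1 ∧ qf S x = mu S := by
  obtain ⟨x, hx, he⟩ := ((sph_compact n).image (qf_cont S)).sSup_mem ((sph_ne hn).image _)
  exact ⟨x, hx, he⟩

lemma mu_le1 {n : ℕ} (S : Matrix (Fin n) (Fin n) ℝ) (x : Fin n → ℝ) (hx : x ⬝ᵥ x = 1) :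
    qf S x ≤ mu S :=
  le_csSup ((sph_compact n).image (qf_cont S)).bddAbove ⟨x, hx, rfl⟩

lemma mu_le {n : ℕ} (S : Matrix (Fin n) (Fin n) ℝ) (x : Fin n → ℝ) :
    qf S x ≤ mu S * (x ⬝ᵥ x) := by
  by_cases h : x ⬝ᵥ x = 0
  · rw [dotProduct_self_eq_zero.1 h]; simp [qf]
  · have hp : 0 < x ⬝ᵥ x := lt_of_le_of_ne
      (Finset.sum_nonneg fun i _ => mul_self_nonneg _) (Ne.symm h)
    have hs := Real.sqrt_pos.2 hp
    have hs2 := Real.mul_self_sqrt hp.le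
    set s := Real.sqrt (x ⬝ᵥ x)
    have := mu_le1 S (s⁻¹ • x) (by
      simp only [smul_dotProduct, dotProduct_smul, smul_eq_mul, ← hs2]; field_simp)
    simp only [qf, mulVec_smul, smul_dotProduct, dotProduct_smul, smul_eq_mul] at this
    rw [← hs2]
    unfold qf
    have h2 := mul_le_mul_of_nonneg_right this (mul_pos hs hs).le
    calc _ = s⁻¹ * (s⁻¹ * x ⬝ᵥ S *ᵥ x) * (s * s) := by field_simp
      _ ≤ _ := h2

lemma mu_unique {n : ℕ} (hn : 2 ≤ n) (S : Matrix (Fin n) (Fin n) ℝ) (hS : ∀ i j, S i j = S j i)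
    (h0 : ∀ i j, i ≠ j → 0 ≤ S i j) (φ : Fin n → ℝ) (hφ : ∀ i, 0 < φ i) (l : ℝ)
    (h : S.mulVec φ = l • φ) : l = mu S := by
  apply le_antisymm
  · have h1 := mu_le S φ
    rw [qf, h, dotProduct_smul, smul_eq_mul] at h1
    have : 0 < φ ⬝ᵥ φ := Finset.sum_pos (fun i _ => mul_pos (hφ i) (hφ i)) ⟨⟨0, by omega⟩, by simp⟩
    exact le_of_mul_le_mul_right h1 this
  · obtain ⟨x, hx, he⟩ := mu_att hn S
    have := picone S hS h0 φ hφ x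
    rw [← he]
    refine this.trans (le_of_eq ?_)
    have e : ∀ i, x i ^ 2 * (S.mulVec φ i / φ i) = (x i * x i) * l := by
      intro i
      have := (hφ i).ne'
      rw [h, Pi.smul_apply, smul_eq_mul]; field_simp
    simp only [e, ← Finset.sum_mul]
    have hx' : ∑ i, x i * x i = 1 := hx
    rw [hx', one_mul]

lemma mu_exists {n : ℕ} (hn : 2 ≤ n) (S : Matrix (Fin n) (Fin n) ℝ) (hS : ∀ i j, S i j = S j i)
    (h0 : ∀ i j, i ≠ j → 0 ≤ S i j)
    (h1 : ∀ i j : Fin n, (i : ℕ) + 1 = (j : ℕ) ∨ (j : ℕ) + 1 = (i : ℕ) → 0 < S i j) :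
    ∃ φ : Fin n → ℝ, (∀ i, 0 < φ i) ∧ S.mulVec φ = mu S • φ := by
  obtain ⟨x, hx, he⟩ := mu_att hn S
  set y : Fin n → ℝ := fun i => |x i| with hy
  have hyn : y ⬝ᵥ y = 1 := by rw [← hx]; simp [dotProduct, hy]
  have hqy : mu S ≤ qf S y := by
    rw [← he, qf_eq, qf_eq]
    refine Finset.sum_le_sum fun i _ => Finset.sum_le_sum fun j _ => ?_
    by_cases hij : i = j
    · subst hij; simp [hy, mul_assoc]
    · rw [mul_assoc, mul_assoc]
      apply mul_le_mul_of_nonneg_left _ (h0 i j hij)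
      simp only [hy, ← abs_mul]; exact le_abs_self _
  have hq : qf S y = mu S := le_antisymm (mu_le1 S y hyn) hqy
  have hP : (mu S • (1 : Matrix (Fin n) (Fin n) ℝ) - S).PosSemidef := by
    refine Matrix.PosSemidef.of_dotProduct_mulVec_nonneg ?_ ?_
    · ext i j
      simp [Matrix.conjTranspose_apply, Matrix.one_apply, hS i j, eq_comm]
    · intro z
      have := mu_le S z
      simp only [star_trivial, sub_mulVec, smul_mulVec, one_mulVec, dotProduct_sub,
        dotProduct_smul, smul_eq_mul]
      unfold qf at this
      linarith
  have hk := (hP.dotProduct_mulVec_zero_iff y).1 (by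
    simp only [star_trivial, sub_mulVec, smul_mulVec, one_mulVec, dotProduct_sub,
        dotProduct_smul, smul_eq_mul]
    unfold qf at hq
    rw [hq, hyn]; ring)
  have hSy : S.mulVec y = mu S • y := by
    rw [sub_mulVec, smul_mulVec, one_mulVec, sub_eq_zero] at hk
    exact hk.symm
  have hy0 : ∀ i, 0 ≤ y i := fun i => abs_nonneg _
  have step : ∀ i j : Fin n, (i : ℕ) + 1 = (j : ℕ) ∨ (j : ℕ) + 1 = (i : ℕ) → y i = 0 → y j = 0 := by
    intro i j hij hi
    have hs : ∑ k, S i k * y k = 0 := by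
      have := congrFun hSy i
      rw [Pi.smul_apply, hi, smul_zero] at this
      exact this
    have hz := (Finset.sum_eq_zero_iff_of_nonneg (fun k _ => by
      by_cases hik : i = k
      · subst hik; simp [hi]
      · exact mul_nonneg (h0 i k hik) (hy0 k))).1 hs j (Finset.mem_univ _)
    exact (mul_eq_zero.1 hz).resolve_left (h1 i j hij).ne'
  refine ⟨y, fun i => lt_of_le_of_ne (hy0 i) fun hi => ?_, hSy⟩
  have up : ∀ m : ℕ, ∀ j : Fin n, (j : ℕ) = i + m → y j = 0 := by
    intro m
    induction m with
    | zero => intro j hj; rw [Fin.ext (a := j) (b := i) (by omega)]; exact hi.symm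
    | succ m ih =>
      intro j hj
      exact step ⟨i + m, by omega⟩ j (Or.inl (by simp; omega)) (ih _ rfl)
  have dn : ∀ m : ℕ, ∀ j : Fin n, (j : ℕ) + m = i → y j = 0 := by
    intro m
    induction m with
    | zero => intro j hj; rw [Fin.ext (a := j) (b := i) (by omega)]; exact hi.symm
    | succ m ih =>
      intro j hj
      exact step ⟨j + 1, by omega⟩ j (Or.inr (by simp)) (ih _ (by simp; omega))
  have hz : y = 0 := by
    ext j
    rcases le_total (i : ℕ) j with h | h
    · exact up (j - i) j (by omega)
    · exact dn (i - j) j (by omega)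
  rw [hz] at hyn
  simp at hyn

noncomputable def Sm (n : ℕ) (r : Fin n → ℝ) (d q : ℝ) : Matrix (Fin n) (Fin n) ℝ :=
  Real.sqrt (d * (d + q)) • Am n + d • diagonal (dl n) - q • 1 + diagonal r

lemma Am_symm (n : ℕ) (i j : Fin n) : Am n i j = Am n j i := by
  simp only [Am, or_comm]

lemma Am_nonneg (n : ℕ) (i j : Fin n) : 0 ≤ Am n i j := by
  unfold Am; split_ifs <;> norm_num

lemma Sm_off (n : ℕ) (r : Fin n → ℝ) (d q : ℝ) (i j : Fin n) (h : i ≠ j) :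
    Sm n r d q i j = Real.sqrt (d * (d + q)) * Am n i j := by
  simp [Sm, h]

lemma Sm_symm (n : ℕ) (r : Fin n → ℝ) (d q : ℝ) (i j : Fin n) :
    Sm n r d q i j = Sm n r d q j i := by
  by_cases h : i = j
  · rw [h]
  · rw [Sm_off _ _ _ _ _ _ h, Sm_off _ _ _ _ _ _ (Ne.symm h), Am_symm]

lemma Sm_nonneg (n : ℕ) (r : Fin n → ℝ) (d q : ℝ) (i j : Fin n) (h : i ≠ j) :
    0 ≤ Sm n r d q i j := by
  rw [Sm_off _ _ _ _ _ _ h]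
  exact mul_nonneg (Real.sqrt_nonneg _) (Am_nonneg _ _ _)

lemma Sm_pos (n : ℕ) (r : Fin n → ℝ) (d q : ℝ) (hd : 0 < d) (hq : 0 ≤ q) (i j : Fin n)
    (h : (i : ℕ) + 1 = (j : ℕ) ∨ (j : ℕ) + 1 = (i : ℕ)) :
    0 < Sm n r d q i j := by
  have hij : i ≠ j := by rintro rfl; omega
  rw [Sm_off _ _ _ _ _ _ hij, Am, if_pos h, mul_one]
  exact Real.sqrt_pos.2 (by positivity)

lemma conj (n : ℕ) (r : Fin n → ℝ) (d q : ℝ) (hd : 0 < d) (hq : 0 ≤ q) :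
    ∃ t : ℝ, 0 < t ∧ ∀ i j : Fin n, (d • Db n + q • Qm n + diagonal r) i j * t ^ (j : ℕ)
      = t ^ (i : ℕ) * Sm n r d q i j := by
  have hs : 0 < Real.sqrt (d * (d + q)) := Real.sqrt_pos.2 (by positivity)
  have hs2 : Real.sqrt (d * (d + q)) * Real.sqrt (d * (d + q)) = d * (d + q) :=
    Real.mul_self_sqrt (by positivity)
  refine ⟨Real.sqrt (d * (d + q)) / d, by positivity, fun i j => ?_⟩
  by_cases hij : i = j
  · subst hij
    rw [mul_comm]; congr 1
    simp [Sm, Am, Db, Qm, dl]; ring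
  · rw [Sm_off _ _ _ _ _ _ hij]
    set s := Real.sqrt (d * (d + q))
    by_cases h1 : (i : ℕ) + 1 = j
    · have h2 : ¬ ((j : ℕ) + 1 = i) := by omega
      have e : (d • Db n + q • Qm n + diagonal r) i j = d := by simp [Db, Qm, h1, h2, hij]
      have e2 : Am n i j = 1 := by simp [Am, h1]
      rw [e, e2, ← h1, pow_succ]
      field_simp
    · by_cases h2 : (j : ℕ) + 1 = i
      · have e : (d • Db n + q • Qm n + diagonal r) i j = d + q := by
          simp [Db, Qm, h2, hij]
        have e2 : Am n i j = 1 := by simp [Am, h2]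
        rw [e, e2, ← h2, pow_succ]
        field_simp
        linarith
      · simp [Am, Db, Qm, h1, h2, hij]

lemma pe_unique {n : ℕ} (hn : 2 ≤ n) (r : Fin n → ℝ) (d q : ℝ) (hd : 0 < d) (hq : 0 ≤ q)
    (l : ℝ) (φ : Fin n → ℝ) (hφ : ∀ i, 0 < φ i)
    (h : (d • Db n + q • Qm n + diagonal r).mulVec φ = l • φ) : l = mu (Sm n r d q) := by
  obtain ⟨t, ht, hc⟩ := conj n r d q hd hq
  refine mu_unique hn _ (Sm_symm n r d q) (Sm_nonneg n r d q) (fun i => φ i / t ^ (i : ℕ))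
    (fun i => div_pos (hφ i) (pow_pos ht _)) l ?_
  ext i
  have hi := congrFun h i
  simp only [mulVec, dotProduct, Pi.smul_apply, smul_eq_mul] at hi ⊢
  have : t ^ (i : ℕ) * ∑ j, Sm n r d q i j * (φ j / t ^ (j : ℕ)) = l * φ i := by
    rw [← hi, Finset.mul_sum]
    refine Finset.sum_congr rfl fun j _ => ?_
    have := pow_pos ht (j : ℕ)
    rw [← mul_assoc, ← hc i j]; field_simp
  have := pow_pos ht (i : ℕ)
  rw [← mul_div_assoc, eq_div_iff this.ne', mul_comm]
  assumption

lemma pe_exists {n : ℕ} (hn : 2 ≤ n) (r : Fin n → ℝ) (d q : ℝ) (hd : 0 < d) (hq : 0 ≤ q) :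
    ∃ φ : Fin n → ℝ, (∀ i, 0 < φ i) ∧
      (d • Db n + q • Qm n + diagonal r).mulVec φ = mu (Sm n r d q) • φ := by
  obtain ⟨t, ht, hc⟩ := conj n r d q hd hq
  obtain ⟨φ, hφ, h⟩ := mu_exists hn _ (Sm_symm n r d q) (Sm_nonneg n r d q) (Sm_pos n r d q hd hq)
  refine ⟨fun i => t ^ (i : ℕ) * φ i, fun i => mul_pos (pow_pos ht _) (hφ i), ?_⟩
  ext i
  have hi := congrFun h i
  simp only [mulVec, dotProduct, Pi.smul_apply, smul_eq_mul] at hi ⊢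
  rw [mul_left_comm, ← hi, Finset.mul_sum]
  refine Finset.sum_congr rfl fun j _ => ?_
  rw [← mul_assoc, ← mul_assoc, hc i j]

lemma qf_lin {n : ℕ} (r : Fin n → ℝ) (d q : ℝ) (x : Fin n → ℝ) :
    qf (Sm n r d q) x = Real.sqrt (d * (d + q)) * qf (Am n) x + d * qf (diagonal (dl n)) x
      - q * (x ⬝ᵥ x) + qf (diagonal r) x := by
  simp only [qf, Sm, add_mulVec, sub_mulVec, smul_mulVec, one_mulVec, dotProduct_add,
    dotProduct_sub, dotProduct_smul, smul_eq_mul]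

lemma Am_mulVec_le {n : ℕ} (φ : Fin n → ℝ) (i : Fin n) : (Am n).mulVec φ i =
    (if h : (i : ℕ) + 1 < n then φ ⟨i + 1, h⟩ else 0) +
    (if h : 0 < (i : ℕ) then φ ⟨i - 1, by omega⟩ else 0) := by
  have e : ∀ j : Fin n, Am n i j * φ j = (if (i : ℕ) + 1 = j then φ j else 0)
      + (if (j : ℕ) + 1 = i then φ j else 0) := by
    intro j
    unfold Am
    by_cases h1 : (i : ℕ) + 1 = j
    · have h2 : ¬ ((j : ℕ) + 1 = i) := by omega
      simp [h1, h2]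
    · simp [h1]
  simp only [mulVec, dotProduct, e, Finset.sum_add_distrib]
  congr 1
  · split_ifs with h
    · rw [Finset.sum_eq_single ⟨i + 1, h⟩]
      · simp
      · intro b _ hb
        rw [if_neg]
        intro hh; exact hb (Fin.ext hh.symm)
      · simp
    · exact Finset.sum_eq_zero fun j _ => if_neg (by omega)
  · split_ifs with h
    · rw [Finset.sum_eq_single ⟨i - 1, by omega⟩]
      · simp; omega
      · intro b _ hb
        rw [if_neg]
        intro hh; exact hb (Fin.ext (by simp; omega))
      · simp
    · exact Finset.sum_eq_zero fun j _ => if_neg (by omega)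

lemma qf_Am_le {n : ℕ} (x : Fin n → ℝ) : qf (Am n) x ≤ 2 * (x ⬝ᵥ x) := by
  refine (picone (Am n) (Am_symm n) (fun i j _ => Am_nonneg n i j) (fun _ => 1)
    (fun _ => one_pos) x).trans ?_
  simp only [dotProduct, Finset.mul_sum]
  refine Finset.sum_le_sum fun i _ => ?_
  have : (Am n).mulVec (fun _ => (1 : ℝ)) i ≤ 2 := by
    rw [Am_mulVec_le]; split_ifs <;> norm_num
  rw [div_one]
  nlinarith [sq_nonneg (x i)]

/-- negative definiteness of D -/
lemma qf_D_neg {n : ℕ} (x : Fin n → ℝ) (hx : x ⬝ᵥ x = 1) :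
    qf (Am n + diagonal (dl n)) x < 0 := by
  have hp : ∀ i : Fin n, (0 : ℝ) < (n : ℝ) ^ 2 + 1 - (i : ℝ) ^ 2 := by
    intro i
    have : (i : ℝ) < n := by exact_mod_cast i.2
    have h0 : (0 : ℝ) ≤ (i : ℝ) := by positivity
    nlinarith
  refine (picone (Am n + diagonal (dl n)) ?_ ?_ (fun i => (n : ℝ) ^ 2 + 1 - (i : ℝ) ^ 2)
    hp x).trans_lt ?_
  · intro i j
    by_cases h : i = j
    · rw [h]
    · simp [h, Ne.symm h, Am_symm n i j]
  · intro i j h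
    simp [h, Am_nonneg]
  · have hneg : ∀ i : Fin n, (Am n + diagonal (dl n)).mulVec
        (fun i => (n : ℝ) ^ 2 + 1 - (i : ℝ) ^ 2) i / ((n : ℝ) ^ 2 + 1 - (i : ℝ) ^ 2) < 0 := by
      intro i
      apply div_neg_of_neg_of_pos _ (hp i)
      rw [add_mulVec, Pi.add_apply, Am_mulVec_le, mulVec_diagonal]
      have hi : (i : ℝ) + 1 ≤ n := by exact_mod_cast i.2
      have h0 : (0 : ℝ) ≤ (i : ℝ) := by positivity
      by_cases hz : (i : ℕ) = 0
      · simp only [hz, dl]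
        split_ifs <;> simp <;> nlinarith
      · have h1 : 0 < (i : ℕ) := by omega
        have hc : ((i - 1 : ℕ) : ℝ) = (i : ℝ) - 1 := by push_cast [Nat.cast_sub h1]; ring
        simp only [dl, hz, h1, dif_pos, if_false, hc]
        split_ifs
        · push_cast; nlinarith
        · have : ¬ ((i : ℕ) + 1 < n) := by assumption
          nlinarith
    obtain ⟨i, hi⟩ : ∃ i, x i ≠ 0 := by
      by_contra! h
      simp [dotProduct, h] at hx
    refine Finset.sum_neg' (fun j _ => ?_) ⟨i, Finset.mem_univ i, ?_⟩
    · exact mul_nonpos_of_nonneg_of_nonpos (sq_nonneg _) (hneg j).le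
    · exact mul_neg_of_pos_of_neg (by positivity) (hneg i)

lemma Sm_cont_q (n : ℕ) (r : Fin n → ℝ) (d : ℝ) : Continuous fun q => mu (Sm n r d q) := by
  apply (mu_cont n).comp
  unfold Sm
  fun_prop

lemma Sm_cont_d (n : ℕ) (r : Fin n → ℝ) (q : ℝ) : Continuous fun d => mu (Sm n r d q) := by
  apply (mu_cont n).comp
  unfold Sm
  fun_prop

lemma qf_d {n : ℕ} (r : Fin n → ℝ) (d : ℝ) (hd : 0 < d) (x : Fin n → ℝ) :
    qf (Sm n r d 0) x = d * qf (Am n + diagonal (dl n)) x + qf (diagonal r) x := by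
  rw [qf_lin, add_zero, Real.sqrt_mul_self hd.le]
  simp only [qf, add_mulVec, dotProduct_add]
  ring

lemma anti_d {n : ℕ} (hn : 2 ≤ n) (r : Fin n → ℝ) (d e : ℝ) (hd : 0 < d) (h : d < e) :
    mu (Sm n r e 0) < mu (Sm n r d 0) := by
  obtain ⟨x, hx, he⟩ := mu_att hn (Sm n r e 0)
  have h1 := mu_le1 (Sm n r d 0) x hx
  rw [qf_d r d hd] at h1
  rw [qf_d r e (hd.trans h)] at he
  nlinarith [qf_D_neg x hx]

lemma diff_q {n : ℕ} (r : Fin n → ℝ) (d p q : ℝ) (hd : 0 < d) (hp : 0 ≤ p) (h : p < q)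
    (x : Fin n → ℝ) (hx : x ⬝ᵥ x = 1) :
    qf (Sm n r d q) x ≤ qf (Sm n r d p) x - (q - p)
      + 2 * (Real.sqrt (d * (d + q)) - Real.sqrt (d * (d + p))) := by
  rw [qf_lin, qf_lin, hx]
  have hs : Real.sqrt (d * (d + p)) ≤ Real.sqrt (d * (d + q)) :=
    Real.sqrt_le_sqrt (by nlinarith)
  have := qf_Am_le x
  rw [hx] at this
  nlinarith

lemma anti_q {n : ℕ} (hn : 2 ≤ n) (r : Fin n → ℝ) (d p q : ℝ) (hd : 0 < d) (hp : 0 ≤ p)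
    (h : p < q) : mu (Sm n r d q) < mu (Sm n r d p) := by
  obtain ⟨x, hx, he⟩ := mu_att hn (Sm n r d q)
  have h1 := mu_le1 (Sm n r d p) x hx
  have h2 := diff_q r d p q hd hp h x hx
  have ha : d ≤ Real.sqrt (d * (d + p)) := Real.le_sqrt_of_sq_le (by nlinarith)
  have hb : d < Real.sqrt (d * (d + q)) := Real.lt_sqrt_of_sq_lt (by nlinarith)
  have ha2 := Real.mul_self_sqrt (show 0 ≤ d * (d + p) by positivity)
  have hb2 := Real.mul_self_sqrt (show 0 ≤ d * (d + q) by
    have : 0 < q := by linarith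
    positivity)
  set a := Real.sqrt (d * (d + p))
  set b := Real.sqrt (d * (d + q))
  have hab : a < b := by nlinarith
  have : d * (2 * (b - a)) < d * (q - p) := by nlinarith
  have := lt_of_mul_lt_mul_left this hd.le
  linarith

lemma exists_q {n : ℕ} (hn : 2 ≤ n) (r : Fin n → ℝ) (d : ℝ) (hd : 0 < d)
    (h : 0 < mu (Sm n r d 0)) : ∃ q, 0 < q ∧ mu (Sm n r d q) = 0 := by
  set m := mu (Sm n r d 0) with hm
  set k : ℝ := m / d + 2 with hk
  have hmd : 0 < m / d := by positivity
  have hdm : d * (m / d) = m := by field_simp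
  set Q : ℝ := d * (k ^ 2 - 1) with hQ
  have hQ0 : 0 < Q := by
    apply mul_pos hd; nlinarith
  have hneg : mu (Sm n r d Q) < 0 := by
    obtain ⟨x, hx, he⟩ := mu_att hn (Sm n r d Q)
    have h1 := mu_le1 (Sm n r d 0) x hx
    have h2 := diff_q r d 0 Q hd le_rfl hQ0 x hx
    have e1 : Real.sqrt (d * (d + Q)) = d * k := by
      rw [show d * (d + Q) = (d * k) * (d * k) by rw [hQ]; ring]
      exact Real.sqrt_mul_self (by positivity)
    rw [e1, add_zero, Real.sqrt_mul_self hd.le] at h2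
    rw [← he]
    have : -(Q - 0) + 2 * (d * k - d) = - (d * (k - 1) ^ 2) := by rw [hQ]; ring
    have h3 : d * (k - 1) ^ 2 = d * (m / d) ^ 2 + 2 * m + d := by
      rw [hk]; linear_combination 2 * hdm
    have : 0 ≤ d * (m / d) ^ 2 := by positivity
    linarith
  obtain ⟨q, hq, he⟩ := intermediate_value_Icc' hQ0.le (Sm_cont_q n r d).continuousOn
    ⟨hneg.le, h.le⟩
  refine ⟨q, lt_of_le_of_ne hq.1 ?_, he⟩
  rintro rfl
  simp only at he
  linarith

lemma exists_d {n : ℕ} (hn : 2 ≤ n) (r : Fin n → ℝ) (hr : ∃ i, 0 < r i) :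
    ∃ d, 0 < d ∧ mu (Sm n r d 0) = 0 := by
  obtain ⟨i, hi⟩ := hr
  have hpos : 0 < mu (Sm n r (r i / 4) 0) := by
    have h1 := mu_le1 (Sm n r (r i / 4) 0) (Pi.single i 1) (by simp)
    refine lt_of_lt_of_le ?_ h1
    have : qf (Sm n r (r i / 4) 0) (Pi.single i 1) = r i / 4 * dl n i + r i := by
      simp [qf, Sm, Am]
    rw [this]
    have : -2 ≤ dl n i := by unfold dl; split_ifs <;> norm_num
    nlinarith
  obtain ⟨z, hz, hze⟩ := mu_att hn (Am n + diagonal (dl n))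
  have hD := qf_D_neg z hz
  rw [hze] at hD
  set c := - mu (Am n + diagonal (dl n)) with hc
  have hc0 : 0 < c := by linarith
  set R := |mu (diagonal r)| with hR
  have hR0 : 0 ≤ R := abs_nonneg _
  set E := r i / 4 + (R + 1) / c with hE
  have hE1 : r i / 4 ≤ E := by rw [hE]; have : 0 ≤ (R + 1) / c := by positivity
                               linarith
  have hE0 : 0 < E := by linarith
  have hEc : R + 1 ≤ E * c := by
    have : E * c = r i / 4 * c + (R + 1) := by rw [hE]; field_simp
    rw [this]
    have : 0 < r i / 4 * c := by positivity
    linarith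
  have hneg : mu (Sm n r E 0) < 0 := by
    obtain ⟨x, hx, he⟩ := mu_att hn (Sm n r E 0)
    rw [← he, qf_d r E hE0]
    have h1 := mu_le1 (Am n + diagonal (dl n)) x hx
    have h2 := mu_le1 (diagonal r) x hx
    have h3 := le_abs_self (mu (diagonal r))
    have h4 := mul_le_mul_of_nonneg_left h1 hE0.le
    have h5 : E * mu (Am n + diagonal (dl n)) = - (E * c) := by rw [hc]; ring
    linarith
  obtain ⟨d, hd, he⟩ := intermediate_value_Icc' hE1 (Sm_cont_d n r 0).continuousOn
    ⟨hneg.le, hpos.le⟩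
  exact ⟨d, by linarith [hd.1], he⟩

/-- in case (b), if `max_i r_i > 0`, there is a unique `d* > 0` at which
the principal eigenvalue of `dD + diag r` vanishes, with sign change across `d*`;
moreover for each `d ∈ (0, d*)` there is a critical advection rate `q*(d) > 0` with the
analogous sign change in `q`. -/
theorem stmt_6 (n : ℕ) (hn : 2 ≤ n) (r : Fin n → ℝ) (hr : ∃ i, 0 < r i) :
    ∃ ds : ℝ, 0 < ds ∧
      (∃ φ : Fin n → ℝ, (∀ i, 0 < φ i) ∧
        (ds • Db n + Matrix.diagonal r).mulVec φ = 0) ∧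
      (∀ d' : ℝ, 0 < d' →
        (∃ φ : Fin n → ℝ, (∀ i, 0 < φ i) ∧
          (d' • Db n + Matrix.diagonal r).mulVec φ = 0) → d' = ds) ∧
      (∀ d : ℝ, 0 < d → d < ds →
        ∀ (lam : ℝ) (φ : Fin n → ℝ), (∀ i, 0 < φ i) →
          (d • Db n + Matrix.diagonal r).mulVec φ = lam • φ → 0 < lam) ∧
      (∀ d : ℝ, ds < d →
        ∀ (lam : ℝ) (φ : Fin n → ℝ), (∀ i, 0 < φ i) →
          (d • Db n + Matrix.diagonal r).mulVec φ = lam • φ → lam < 0) ∧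
      (∀ d : ℝ, 0 < d → d < ds → ∃ qs : ℝ, 0 < qs ∧
        (∃ φ : Fin n → ℝ, (∀ i, 0 < φ i) ∧
          (d • Db n + qs • Qm n + Matrix.diagonal r).mulVec φ = 0) ∧
        (∀ q : ℝ, 0 ≤ q → q < qs →
          ∀ (lam : ℝ) (φ : Fin n → ℝ), (∀ i, 0 < φ i) →
            (d • Db n + q • Qm n + Matrix.diagonal r).mulVec φ = lam • φ → 0 < lam) ∧
        (∀ q : ℝ, qs < q →
          ∀ (lam : ℝ) (φ : Fin n → ℝ), (∀ i, 0 < φ i) →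
            (d • Db n + q • Qm n + Matrix.diagonal r).mulVec φ = lam • φ → lam < 0)) := by
  have conv : ∀ d : ℝ, d • Db n + diagonal r = d • Db n + (0 : ℝ) • Qm n + diagonal r := by
    intro d; simp
  obtain ⟨ds, hds, h0⟩ := exists_d hn r hr
  refine ⟨ds, hds, ?_, ?_, ?_, ?_, ?_⟩
  · obtain ⟨φ, hφ, h⟩ := pe_exists hn r ds 0 hds le_rfl
    exact ⟨φ, hφ, by rw [conv, h, h0, zero_smul]⟩
  · rintro d hd ⟨φ, hφ, h⟩
    rw [conv] at h
    have := pe_unique hn r d 0 hd le_rfl 0 φ hφ (by rw [h, zero_smul])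
    rcases lt_trichotomy d ds with hl | hl | hl
    · have := anti_d hn r d ds hd hl; linarith
    · exact hl
    · have := anti_d hn r ds d hds hl; linarith
  · intro d hd hl lam φ hφ h
    rw [conv] at h
    rw [pe_unique hn r d 0 hd le_rfl lam φ hφ h]
    exact h0.symm.trans_lt (anti_d hn r d ds hd hl)
  · intro d hl lam φ hφ h
    rw [conv] at h
    rw [pe_unique hn r d 0 (hds.trans hl) le_rfl lam φ hφ h]
    exact (anti_d hn r ds d hds hl).trans_eq h0
  · intro d hd hl
    obtain ⟨qs, hqs, hq0⟩ := exists_q hn r d hd (h0.symm.trans_lt (anti_d hn r d ds hd hl))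
    refine ⟨qs, hqs, ?_, ?_, ?_⟩
    · obtain ⟨φ, hφ, h⟩ := pe_exists hn r d qs hd hqs.le
      exact ⟨φ, hφ, by rw [h, hq0, zero_smul]⟩
    · intro q hq hlt lam φ hφ h
      rw [pe_unique hn r d q hd hq lam φ hφ h, ← hq0]
      exact anti_q hn r d q qs hd hq hlt
    · intro q hlt lam φ hφ h
      rw [pe_unique hn r d q hd (hqs.le.trans hlt.le) lam φ hφ h, ← hq0]
      exact anti_q hn r d qs q hd hqs.le hlt
end

section
/- Consider case (a) and let r ∈ ℝⁿ with rᵢ > 0 for all i. Suppose 0 < d₂ < d₁, q₁, q₂ > 0, and there exist positive vectors φ ≫ 0, ψ ≫ 0 such that (d₁D + q₁Q + diag(r))φ = 0 and (d₂D + q₂Q + diag(r))ψ = 0. Then q₂ < q₁. (That is, the critical advection rate q*_r(d), defined by λ₁(d, q*_r(d), r) = 0, is strictly increasing in d on (0,∞).) -/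
open Matrix Filter

lemma row_aux (m : ℕ) (r φ : Fin (m+2) → ℝ) (d q : ℝ)
    (h : (d • Da (m+2) + q • Qm (m+2) + Matrix.diagonal r).mulVec φ = 0)
    (f R : ℕ → ℝ) (hf : ∀ i : Fin (m+2), φ i = f i) (hR : ∀ i : Fin (m+2), r i = R i) :
    d * f 1 - (d + q) * f 0 + R 0 * f 0 = 0 ∧
    (∀ k, k < m → d * f (k+2) - (2 * d + q) * f (k+1) + (d + q) * f k + R (k+1) * f (k+1) = 0) ∧
    (- (d + q) * f (m+1) + (d + q) * f m + R (m+1) * f (m+1) = 0) := by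
  have key : ∀ i, i < m + 2 → ∑ j ∈ Finset.range (m+2),
      ((if j = i + 1 then d * f j else 0) + (if j + 1 = i then (d + q) * f j else 0)
       + (if j = i then ((if i = 0 ∨ i = m + 1 then -d else -2*d) - q + R i) * f j else 0)) = 0 := by
    intro i hi
    have := congrFun h ⟨i, hi⟩
    simp only [Matrix.mulVec, dotProduct, Pi.zero_apply] at this
    rw [Finset.sum_range]
    refine Eq.trans ?_ this
    refine Finset.sum_congr rfl fun j _ => ?_
    rw [hf j]
    simp only [Matrix.add_apply, Matrix.smul_apply, smul_eq_mul, Da, Qm, Matrix.diagonal_apply, hR,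
      Fin.ext_iff]
    have e : m + 2 - 1 = m + 1 := rfl
    rw [e]
    rcases lt_trichotomy (j : ℕ) i with hlt | heq | hgt
    · by_cases h1 : (j : ℕ) + 1 = i
      · simp [h1, show ¬ (j : ℕ) = i + 1 by omega, show ¬ (j : ℕ) = i by omega, show ¬ i = j by omega]
      · simp [h1, show ¬ (j : ℕ) = i + 1 by omega, show ¬ (j : ℕ) = i by omega, show ¬ i = j by omega,
          show ¬ i + 1 = j by omega]
    · rw [heq]
      by_cases h2 : i = 0 ∨ i = m + 1
      · simp [h2]; left; ring
      · simp [h2]; left; ring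
    · by_cases h1 : (j : ℕ) = i + 1
      · simp [h1, show ¬ i + 1 + 1 = i by omega]
      · simp [h1, show ¬ (j : ℕ) + 1 = i by omega, show ¬ (j : ℕ) = i by omega, show ¬ i = j by omega,
          show ¬ i + 1 = j by omega]
  refine ⟨?_, ?_, ?_⟩
  · have := key 0 (by omega)
    simp [Finset.sum_add_distrib] at this
    linarith
  · intro k hk
    have := key (k+1) (by omega)
    simp [Finset.sum_add_distrib, show k < m + 2 by omega, show k < m + 1 by omega,
      hk, show ¬ k = m by omega] at this
    linarith
  · have := key (m+1) (by omega)
    simp [Finset.sum_add_distrib] at this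
    linarith

lemma ric_aux (m : ℕ) (r φ : Fin (m+2) → ℝ) (d q : ℝ) (hd : 0 < d) (hq : 0 < q)
    (h : (d • Da (m+2) + q • Qm (m+2) + Matrix.diagonal r).mulVec φ = 0)
    (hφ : ∀ i, 0 < φ i) (R : ℕ → ℝ) (hR : ∀ i : Fin (m+2), r i = R i) (hRp : ∀ i, 0 < R i) :
    ∃ g : ℕ → ℝ, g 0 = R 0 ∧ g (m+1) = q ∧ (∀ i, i ≤ m → 0 < g i ∧ g i < q) ∧
      ∀ i, i ≤ m → g (i+1) = R (i+1) + d * g i / (d + q - g i) := by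
  obtain ⟨f, hf, hfp⟩ : ∃ f : ℕ → ℝ, (∀ i : Fin (m+2), φ i = f i) ∧ ∀ i, 0 < f i := by
    refine ⟨fun i => if h : i < m + 2 then φ ⟨i, h⟩ else 1, fun i => by simp, fun i => ?_⟩
    dsimp only
    split_ifs
    · exact hφ _
    · exact one_pos
  obtain ⟨e0, e1, e2⟩ := row_aux m r φ d q h f R hf hR
  let g : ℕ → ℝ := fun i => if i ≤ m then d + q - d * f (i+1) / f i else q
  have hg : ∀ i, i ≤ m → g i = d + q - d * f (i+1) / f i := fun i hi => if_pos hi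
  have hgl : g (m+1) = q := if_neg (by omega)
  have g0 : g 0 = R 0 := by
    rw [hg 0 (Nat.zero_le _)]
    have := (hfp 0).ne'
    field_simp
    simp only [zero_add]
    linarith
  have hlt : ∀ i, i ≤ m → g i < d + q := fun i hi => by
    rw [hg i hi]
    have : 0 < d * f (i+1) / f i := div_pos (mul_pos hd (hfp _)) (hfp _)
    linarith
  have hrec : ∀ i, i ≤ m → g (i+1) = R (i+1) + d * g i / (d + q - g i) := fun i hi => by
    have a := (hfp i).ne'
    have b := (hfp (i+1)).ne'
    have c := hd.ne'
    have key : d * g i / (d + q - g i) = (d + q) * f i / f (i+1) - d := by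
      rw [hg i hi, sub_sub_cancel]
      field_simp
    rw [key]
    rcases hi.lt_or_eq with hi | rfl
    · rw [hg (i+1) hi]
      field_simp
      linarith [e1 i hi]
    · rw [hgl]
      field_simp
      linarith [e2]
  have pos : ∀ i, i ≤ m → 0 < g i := by
    intro i
    induction i with
    | zero => intro _; rw [g0]; exact hRp 0
    | succ k ih =>
      intro hk
      rw [hrec k (by omega)]
      have := hlt k (by omega)
      have := div_pos (mul_pos hd (ih (by omega))) (sub_pos.2 this)
      linarith [hRp (k+1)]
  have step : ∀ i, i ≤ m → q ≤ g i → q < g (i+1) := fun i hi hqi => by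
    rw [hrec i hi]
    have h3 := sub_pos.2 (hlt i hi)
    have : q ≤ d * g i / (d + q - g i) := by
      rw [le_div_iff₀ h3]
      nlinarith
    linarith [hRp (i+1)]
  have lt : ∀ k i, i + k = m → g i < q := by
    intro k
    induction k with
    | zero =>
      intro i hi
      by_contra hc
      have := step i (by omega) (not_lt.1 hc)
      rw [show i = m by omega, hgl] at this
      exact lt_irrefl _ this
    | succ k ih =>
      intro i hi
      by_contra hc
      exact absurd (step i (by omega) (not_lt.1 hc)) (ih (i+1) (by omega)).not_gt
  exact ⟨g, g0, hgl, fun i hi => ⟨pos i hi, lt (m - i) i (by omega)⟩, hrec⟩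

lemma cmp_aux (d₁ d₂ q₁ q₂ g h : ℝ) (hd2 : 0 < d₂) (hd21 : d₂ < d₁) (hq : q₁ ≤ q₂)
    (hh : 0 < h) (hhq : h < q₂) (hgq : g < q₁) (hle : h ≤ g) :
    d₂ * h / (d₂ + q₂ - h) < d₁ * g / (d₁ + q₁ - g) := by
  have hg : 0 < g := by linarith
  rw [div_lt_div_iff₀ (by linarith) (by linarith)]
  have a1 : h * (q₁ - g) ≤ g * (q₂ - h) := by
    apply mul_le_mul hle <;> linarith
  have a2 : d₂ * (h * (q₁ - g)) ≤ d₂ * (g * (q₂ - h)) := mul_le_mul_of_nonneg_left a1 hd2.le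
  have a3 : d₂ * (g * (q₂ - h)) < d₁ * (g * (q₂ - h)) :=
    mul_lt_mul_of_pos_right hd21 (mul_pos hg (by linarith))
  have a4 : d₁ * d₂ * h ≤ d₁ * d₂ * g :=
    mul_le_mul_of_nonneg_left hle (mul_nonneg (by linarith) hd2.le)
  nlinarith

/-- in case (a) with `r ≫ 0`, the critical advection rate `q*_r(d)` is
strictly increasing in `d`. -/
theorem stmt_7 (n : ℕ) (hn : 2 ≤ n) (r : Fin n → ℝ) (hr : ∀ i, 0 < r i)
    (d₁ d₂ q₁ q₂ : ℝ) (hd2 : 0 < d₂) (hd21 : d₂ < d₁) (hq1 : 0 < q₁) (hq2 : 0 < q₂)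
    (φ ψ : Fin n → ℝ) (hφ : ∀ i, 0 < φ i) (hψ : ∀ i, 0 < ψ i)
    (h1 : (d₁ • Da n + q₁ • Qm n + Matrix.diagonal r).mulVec φ = 0)
    (h2 : (d₂ • Da n + q₂ • Qm n + Matrix.diagonal r).mulVec ψ = 0) :
    q₂ < q₁ := by
  obtain ⟨m, rfl⟩ : ∃ m, n = m + 2 := ⟨n - 2, by omega⟩
  obtain ⟨R, hR, hRp⟩ : ∃ f : ℕ → ℝ, (∀ i : Fin (m+2), r i = f i) ∧ ∀ i, 0 < f i := by
    refine ⟨fun i => if h : i < m + 2 then r ⟨i, h⟩ else 1, fun i => by simp, fun i => ?_⟩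
    dsimp only
    split_ifs
    · exact hr _
    · exact one_pos
  obtain ⟨g, g0, gl, gb, grec⟩ := ric_aux m r φ d₁ q₁ (hd2.trans hd21) hq1 h1 hφ R hR hRp
  obtain ⟨k, k0, kl, kb, krec⟩ := ric_aux m r ψ d₂ q₂ hd2 hq2 h2 hψ R hR hRp
  by_contra hc
  have hq := not_lt.1 hc
  have st : ∀ i, i ≤ m → k i ≤ g i → k (i+1) < g (i+1) := fun i hi hle => by
    rw [krec i hi, grec i hi]
    have := cmp_aux d₁ d₂ q₁ q₂ (g i) (k i) hd2 hd21 hq (kb i hi).1 (kb i hi).2 (gb i hi).2 hle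
    linarith
  have all : ∀ i, i ≤ m → k i ≤ g i := by
    intro i
    induction i with
    | zero => intro _; rw [k0, g0]
    | succ j ih => intro hj; exact (st j (by omega) (ih (by omega))).le
  have := st m le_rfl (all m le_rfl)
  rw [kl, gl] at this
  linarith
end

section
/- Consider case (a). Let r, r′ ∈ ℝⁿ satisfy r′ᵢ > 0 for all i, rᵢ ≥ r′ᵢ for all i, and r ≠ r′. Fix d > 0. If q, q′ > 0 and there exist positive vectors φ ≫ 0, ψ ≫ 0 such that (dD + qQ + diag(r))φ = 0 and (dD + q′Q + diag(r′))ψ = 0, then q > q′. (That is, r > r′ ≫ 0 implies q*_r(d) > q*_{r′}(d) for every d > 0.) -/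
open Matrix Filter

lemma row_eq (n : ℕ) (hn : 2 ≤ n) (r : Fin n → ℝ) (d q : ℝ) (φ : Fin n → ℝ)
    (h : (d • Da n + q • Qm n + Matrix.diagonal r).mulVec φ = 0)
    (F R : ℕ → ℝ) (hF : ∀ i : Fin n, φ i = F i) (hR : ∀ i : Fin n, r i = R i)
    (hFn : F n = F (n - 1)) :
    (d * (F 1 - F 0) + R 0 * F 0 = q * F 0) ∧
    ∀ i, i + 1 < n → d * (F (i + 2) - F (i + 1)) + R (i + 1) * F (i + 1)
      = (d + q) * (F (i + 1) - F i) := by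
  have key : ∀ i, i < n → ∑ k ∈ Finset.range n,
      ((if k + 1 = i then (d + q) * F k else 0) + (if i + 1 = k then d * F k else 0)
        + (if i = k then (d * (if i = 0 ∨ i = n - 1 then -1 else -2) - q + R i) * F k else 0)) = 0 := by
    intro i hi
    have h' := congrFun h ⟨i, hi⟩
    rw [← Fin.sum_univ_eq_sum_range (fun k =>
      ((if k + 1 = i then (d + q) * F k else 0) + (if i + 1 = k then d * F k else 0)
        + (if i = k then (d * (if i = 0 ∨ i = n - 1 then -1 else -2) - q + R i) * F k else 0))) n]
    simp only [Matrix.mulVec, dotProduct, Pi.zero_apply] at h'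
    refine Eq.trans ?_ h'
    refine Finset.sum_congr rfl fun j _ => ?_
    simp only [Matrix.add_apply, Matrix.smul_apply, Da, Qm, Matrix.diagonal_apply, smul_eq_mul,
      hF, hR, Fin.ext_iff]
    by_cases a : (j : ℕ) + 1 = i
    · have b : ¬ (i + 1 = (j : ℕ)) := by omega
      have c : ¬ (i = (j : ℕ)) := by omega
      simp [a, b, c]
    · by_cases b : i + 1 = (j : ℕ)
      · have c : ¬ (i = (j : ℕ)) := by omega
        simp [a, b, c]
      · by_cases c : i = (j : ℕ)
        · simp only [a, b, c, if_true, if_false, or_self]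
          simp
          try left
          ring
        · simp [a, b, c]
  constructor
  · have h0 := key 0 (by omega)
    simp only [Finset.sum_add_distrib, Finset.sum_ite_eq, Finset.mem_range] at h0
    rw [if_pos (by omega : 0 + 1 < n), if_pos (by omega : 0 < n)] at h0
    simp at h0
    linarith
  · intro i hi
    have h0 := key (i + 1) hi
    simp only [Finset.sum_add_distrib, Finset.sum_ite_eq, Finset.sum_ite_eq', Finset.mem_range,
      add_left_inj] at h0
    rw [if_pos hi, if_pos (by omega : i < n)] at h0
    by_cases e : i + 2 = n
    · rw [if_neg (by omega), if_pos (by omega)] at h0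
      have : F (i + 2) = F (i + 1) := by rw [e, hFn]; congr 1; omega
      rw [this]; linarith
    · rw [if_pos (by omega), if_neg (by omega)] at h0
      have : i + 1 + 1 = i + 2 := rfl
      rw [this] at h0
      linarith

lemma ratio_eq (n : ℕ) (hn : 2 ≤ n) (r : Fin n → ℝ) (d q : ℝ) (φ : Fin n → ℝ)
    (hφ : ∀ i, 0 < φ i)
    (h : (d • Da n + q • Qm n + Matrix.diagonal r).mulVec φ = 0)
    (R : ℕ → ℝ) (hR : ∀ i : Fin n, r i = R i) :
    ∃ u : ℕ → ℝ, (∀ i, 0 < u i) ∧ u (n - 1) = 1 ∧ d * (u 0 - 1) + R 0 = q ∧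
      ∀ i, i + 1 < n → d * (u (i + 1) - 1) + R (i + 1) = (d + q) * (1 - 1 / u i) := by
  let F : ℕ → ℝ := fun k => if hk : k < n then φ ⟨k, hk⟩ else φ ⟨n - 1, by omega⟩
  have hF : ∀ i : Fin n, φ i = F i := fun i => by simp [F]
  have hpos : ∀ i, 0 < F i := by
    intro i; simp only [F]; split_ifs <;> exact hφ _
  have hFn : F n = F (n - 1) := by
    simp only [F]; rw [dif_neg (by omega), dif_pos (by omega)]
  obtain ⟨a, b⟩ := row_eq n hn r d q φ h F R hF hR hFn
  refine ⟨fun i => F (i + 1) / F i, fun i => div_pos (hpos _) (hpos _), ?_, ?_, ?_⟩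
  · have : n - 1 + 1 = n := by omega
    simp only [this, hFn]
    exact div_self (hpos _).ne'
  · have := (hpos 0).ne'
    simp only [zero_add]
    field_simp
    linarith
  · intro i hi
    have h0 := (hpos i).ne'
    have h1 := (hpos (i + 1)).ne'
    have := b i hi
    have e : i + 1 + 1 = i + 2 := rfl
    simp only [e]
    field_simp
    linarith

theorem stmt_9 (n : ℕ) (hn : 2 ≤ n) (r r' : Fin n → ℝ)
    (hr' : ∀ i, 0 < r' i) (hle : ∀ i, r' i ≤ r i) (hne : r ≠ r')
    (d : ℝ) (hd : 0 < d) (q q' : ℝ) (hq : 0 < q) (hq' : 0 < q')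
    (φ ψ : Fin n → ℝ) (hφ : ∀ i, 0 < φ i) (hψ : ∀ i, 0 < ψ i)
    (h1 : (d • Da n + q • Qm n + Matrix.diagonal r).mulVec φ = 0)
    (h2 : (d • Da n + q' • Qm n + Matrix.diagonal r').mulVec ψ = 0) :
    q' < q := by
  by_contra! hqq
  let R : ℕ → ℝ := fun k => if hk : k < n then r ⟨k, hk⟩ else 1
  let R' : ℕ → ℝ := fun k => if hk : k < n then r' ⟨k, hk⟩ else 1
  have hR : ∀ i : Fin n, r i = R i := fun i => by simp [R]
  have hR' : ∀ i : Fin n, r' i = R' i := fun i => by simp [R']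
  have hRle : ∀ i, R' i ≤ R i := by
    intro i; simp only [R, R']; split_ifs
    · exact hle _
    · exact le_rfl
  have hRpos : ∀ i, 0 < R' i := by
    intro i; simp only [R']; split_ifs
    · exact hr' _
    · exact one_pos
  obtain ⟨j0, hj0⟩ := Function.ne_iff.mp hne
  have hj : R' j0 < R j0 := lt_of_le_of_ne (hRle _) (by rw [← hR, ← hR']; exact hj0.symm)
  obtain ⟨u, hu, un, u0, us⟩ := ratio_eq n hn r d q φ hφ h1 R hR
  obtain ⟨v, hv, vn, v0, vs⟩ := ratio_eq n hn r' d q' ψ hψ h2 R' hR'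
  have main : ∀ k, ∀ i, i + k = n - 1 →
      1 ≤ v i ∧ v i ≤ u i ∧ (i < (j0 : ℕ) → v i < u i) := by
    intro k
    induction k with
    | zero =>
      intro i hi
      have : i = n - 1 := by omega
      subst this
      refine ⟨vn.ge, by rw [un, vn], fun hlt => ?_⟩
      have := j0.2
      omega
    | succ k ih =>
      intro i hi
      obtain ⟨a, b, c⟩ := ih (i + 1) (by omega)
      have e1 := us i (by omega)
      have e2 := vs i (by omega)
      have p := hRpos (i + 1)
      have l := hRle (i + 1)
      have m1 : d * (v (i + 1) - 1) ≤ d * (u (i + 1) - 1) := by gcongr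
      have m0 : 0 ≤ d * (v (i + 1) - 1) := mul_nonneg hd.le (by linarith)
      have zv : 0 < 1 - 1 / v i := by
        by_contra! hc
        have := mul_nonpos_of_nonneg_of_nonpos (by linarith : 0 ≤ d + q') hc
        linarith
      have m2 : (d + q) * (1 - 1 / v i) ≤ (d + q') * (1 - 1 / v i) := by gcongr
      refine ⟨?_, ?_, ?_⟩
      · have : 1 / v i ≤ 1 := by linarith
        rwa [div_le_one (hv i)] at this
      · have : (d + q) * (1 - 1 / v i) ≤ (d + q) * (1 - 1 / u i) := by linarith
        have := le_of_mul_le_mul_left this (by linarith)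
        exact (one_div_le_one_div (hu i) (hv i)).mp (by linarith)
      · intro hlt
        have : (d + q) * (1 - 1 / v i) < (d + q) * (1 - 1 / u i) := by
          rcases Nat.lt_or_ge (i + 1) j0 with h | h
          · have : d * (v (i + 1) - 1) < d * (u (i + 1) - 1) := by
              have := c h
              gcongr
            linarith
          · have : (j0 : ℕ) = i + 1 := by omega
            rw [this] at hj
            linarith
        have := lt_of_mul_lt_mul_left this (by linarith)
        exact (one_div_lt_one_div (hu i) (hv i)).mp (by linarith)
  obtain ⟨a, b, c⟩ := main (n - 1) 0 (by omega)
  have l := hRle 0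
  rcases Nat.eq_zero_or_pos (j0 : ℕ) with h | h
  · rw [h] at hj
    have : d * (v 0 - 1) ≤ d * (u 0 - 1) := by gcongr
    linarith
  · have : d * (v 0 - 1) < d * (u 0 - 1) := by
      have := c h
      gcongr
    linarith
end

section
/- Consider case (b). Let r ∈ ℝⁿ with max_{1≤i≤n} r_i > 0, and let d* > 0 be the unique value such that d*D + diag(r) has eigenvalue 0 with a positive eigenvector. (i) For every ε > 0 there exists δ > 0 such that: whenever 0 < d < δ, q > 0, and there exists φ ≫ 0 with (dD + qQ + diag(r))φ = 0, one has |q − max_{1≤i≤n} r_i| < ε. (ii) For every ε > 0 there exists δ > 0 such that: whenever d* − δ < d < d*, q > 0, and there exists φ ≫ 0 with (dD + qQ + diag(r))φ = 0, one has q < ε. (That is, the critical advection rate q*_r(d) satisfies q*_r(d) → max_i r_i as d → 0 and q*_r(d) → 0 as d → d*.) -/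
open Matrix Filter

lemma sum_ite_le_aux {n : ℕ} (P : Fin n → Prop) [DecidablePred P]
    (hP : ∀ j k, P j → P k → j = k) (f : Fin n → ℝ) (B : ℝ) (hB : 0 ≤ B)
    (hf : ∀ j, P j → f j ≤ B) : ∑ j, (if P j then f j else 0) ≤ B := by
  by_cases h : ∃ j, P j
  · obtain ⟨j, hj⟩ := h
    rw [Finset.sum_eq_single j]
    · rw [if_pos hj]; exact hf j hj
    · intro k _ hk
      rw [if_neg]
      intro h2
      exact hk (hP k j h2 hj)
    · simp
  · push Not at h
    simpa [h] using hB

lemma perron_aux {n : ℕ} (K : Fin n → Fin n → ℝ) (hs : ∀ i j, K i j = K j i)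
    (hK : ∀ i j, i ≠ j → 0 ≤ K i j) (v : Fin n → ℝ) (hv : ∀ i, 0 < v i) (u : Fin n → ℝ) :
    ∑ i, ∑ j, u i * K i j * u j ≤ ∑ i, u i ^ 2 / v i * ∑ j, K i j * v j := by
  have h1 : ∑ i, u i ^ 2 / v i * ∑ j, K i j * v j
      = ∑ i, ∑ j, K i j * (u i ^ 2 / v i * v j) := by
    refine Finset.sum_congr rfl fun i _ => ?_
    rw [Finset.mul_sum]
    refine Finset.sum_congr rfl fun j _ => ?_
    ring
  have h2 : ∑ i, ∑ j, K i j * (u i ^ 2 / v i * v j)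
      = ∑ i, ∑ j, K i j * (u j ^ 2 / v j * v i) := by
    rw [Finset.sum_comm]
    refine Finset.sum_congr rfl fun i _ => Finset.sum_congr rfl fun j _ => ?_
    rw [hs j i]
  have h3 : 2 * ∑ i, ∑ j, u i * K i j * u j ≤ ∑ i, ∑ j, K i j * (u i ^ 2 / v i * v j)
      + ∑ i, ∑ j, K i j * (u j ^ 2 / v j * v i) := by
    rw [Finset.mul_sum, ← Finset.sum_add_distrib]
    refine Finset.sum_le_sum fun i _ => ?_
    rw [Finset.mul_sum, ← Finset.sum_add_distrib]
    refine Finset.sum_le_sum fun j _ => ?_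
    have hi := hv i
    have hj := hv j
    by_cases hij : i = j
    · subst hij
      apply le_of_eq
      field_simp
      ring
    · have hk := hK i j hij
      have : 2 * (u i * u j) ≤ u i ^ 2 / v i * v j + u j ^ 2 / v j * v i := by
        have e : u i ^ 2 / v i * v j + u j ^ 2 / v j * v i - 2 * (u i * u j)
            = (u i * v j - u j * v i) ^ 2 / (v i * v j) := by
          field_simp
          ring
        have : 0 ≤ (u i * v j - u j * v i) ^ 2 / (v i * v j) := by positivity
        linarith
      nlinarith
  linarith

lemma Db_symm_aux (n : ℕ) (i j : Fin n) : Db n i j = Db n j i := by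
  unfold Db
  by_cases h : i = j
  · subst h; rfl
  · have h' : j ≠ i := fun e => h e.symm
    simp only [h, h', if_false, or_comm]

lemma Db_off_aux (n : ℕ) (i j : Fin n) (h : i ≠ j) : 0 ≤ Db n i j := by
  unfold Db
  simp only [h, if_false]
  split_ifs <;> norm_num

lemma Db_row_aux (n : ℕ) (i : Fin n) : ∑ j, Db n i j ≤ 0 := by
  have h : ∑ j, Db n i j ≤ ∑ j : Fin n, ((if (i : ℕ) + 1 = (j : ℕ) then (1:ℝ) else 0)
      + (if (j : ℕ) + 1 = (i : ℕ) then (1:ℝ) else 0)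
      + (if i = j then (if (i : ℕ) = 0 then -1 else -2) else 0)) := by
    refine Finset.sum_le_sum fun j _ => ?_
    unfold Db
    by_cases hij : i = j
    · subst hij; simp
    · simp only [hij, if_false]
      split_ifs <;> simp_all
  refine h.trans ?_
  rw [Finset.sum_add_distrib, Finset.sum_add_distrib, Finset.sum_ite_eq]
  have a1 := sum_ite_le_aux (fun j : Fin n => (i : ℕ) + 1 = (j : ℕ))
    (fun j k hj hk => Fin.ext (by omega)) (fun _ => 1) 1 (by norm_num) (fun _ _ => le_rfl)
  by_cases hi : (i : ℕ) = 0
  · have a2 := sum_ite_le_aux (fun j : Fin n => (j : ℕ) + 1 = (i : ℕ))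
      (fun j k hj hk => Fin.ext (by omega)) (fun _ => 1) 0 (by norm_num)
      (fun j hj => by omega)
    simp only [hi, Finset.mem_univ, if_true] at *
    linarith
  · have a2 := sum_ite_le_aux (fun j : Fin n => (j : ℕ) + 1 = (i : ℕ))
      (fun j k hj hk => Fin.ext (by omega)) (fun _ => 1) 1 (by norm_num) (fun _ _ => le_rfl)
    simp only [hi, Finset.mem_univ, if_true, if_false] at *
    linarith

lemma Db_neg_aux (n : ℕ) (u : Fin n → ℝ) : ∑ i, ∑ j, u i * Db n i j * u j ≤ 0 := by
  refine (perron_aux (Db n) (Db_symm_aux n) (Db_off_aux n) (fun _ => 1) (fun _ => one_pos) u).trans ?_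
  refine Finset.sum_nonpos fun i _ => ?_
  have := Db_row_aux n i
  simp only [mul_one, div_one]
  nlinarith [sq_nonneg (u i)]

lemma eqn_aux {n : ℕ} {r φ : Fin n → ℝ} {d q : ℝ}
    (h : (d • Db n + q • Qm n + Matrix.diagonal r).mulVec φ = 0) (i : Fin n) :
    ∑ j, (d * Db n i j + q * Qm n i j + (if i = j then r i else 0)) * φ j = 0 := by
  have := congrFun h i
  simpa [Matrix.mulVec, dotProduct, Matrix.diagonal_apply] using this

lemma lower_aux {n : ℕ} {r φ : Fin n → ℝ} {d q : ℝ} (hd : 0 < d) (hq : 0 < q)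
    (hφ : ∀ i, 0 < φ i)
    (h : (d • Db n + q • Qm n + Matrix.diagonal r).mulVec φ = 0) (i : Fin n) :
    r i - 2 * d ≤ q := by
  have h0 := eqn_aux h i
  have h1 : ∑ j, (if i = j then (r i - 2 * d - q) * φ j else 0) ≤ 0 := by
    refine le_trans ?_ h0.le
    refine Finset.sum_le_sum fun j _ => ?_
    have := hφ j
    by_cases hij : i = j
    · subst hij
      simp only [if_true]
      refine mul_le_mul_of_nonneg_right ?_ this.le
      unfold Db Qm
      simp
      split_ifs <;> linarith
    · simp only [hij, if_false, add_zero]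
      refine mul_nonneg ?_ this.le
      have a1 := Db_off_aux n i j hij
      have a2 : 0 ≤ Qm n i j := by
        unfold Qm; simp only [hij, if_false]; split_ifs <;> norm_num
      positivity
  rw [Finset.sum_ite_eq] at h1
  simp only [Finset.mem_univ, if_true] at h1
  by_contra hc
  push Not at hc
  have : 0 < (r i - 2 * d - q) * φ i := mul_pos (by linarith) (hφ i)
  linarith

lemma upper_aux {n : ℕ} (hn : 2 ≤ n) {r φ : Fin n → ℝ} {d q m η : ℝ} (hd : 0 < d) (hq : 0 < q)
    (hm : ∀ i, r i ≤ m) (hη : 0 < η) 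
    (hφ : ∀ i, 0 < φ i)
    (h : (d • Db n + q • Qm n + Matrix.diagonal r).mulVec φ = 0) :
    0 ≤ d / η + (d + q) * η - d - q + m := by
  by_contra hc
  push Not at hc
  have h0 : ∑ i : Fin n, η ^ (i : ℕ) * ∑ j, (d * Db n i j + q * Qm n i j + (if i = j then r i else 0)) * φ j = 0 :=
    Finset.sum_eq_zero fun i _ => by rw [eqn_aux h i, mul_zero]
  have h1 : ∑ j, φ j * ∑ i : Fin n, η ^ (i : ℕ) * (d * Db n i j + q * Qm n i j + (if i = j then r i else 0)) = 0 := by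
    refine Eq.trans ?_ h0
    simp_rw [Finset.mul_sum]
    rw [Finset.sum_comm]
    refine Finset.sum_congr rfl fun i _ => Finset.sum_congr rfl fun j _ => ?_
    ring
  have h2 : ∀ j : Fin n, ∑ i : Fin n, η ^ (i : ℕ) * (d * Db n i j + q * Qm n i j + (if i = j then r i else 0)) < 0 := by
    intro j
    have hj : 0 < η ^ (j : ℕ) := by positivity
    have b : ∑ i : Fin n, η ^ (i : ℕ) * (d * Db n i j + q * Qm n i j + (if i = j then r i else 0))
      ≤ ∑ i : Fin n, ((if (i : ℕ) + 1 = (j : ℕ) then d * η ^ (i : ℕ) else 0)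
        + (if (j : ℕ) + 1 = (i : ℕ) then (d + q) * η ^ (i : ℕ) else 0)
        + (if i = j then (- d - q + m) * η ^ (i : ℕ) else 0)) := by
      refine Finset.sum_le_sum fun i _ => ?_
      have hi : 0 < η ^ (i : ℕ) := by positivity
      by_cases hij : i = j
      · subst hij
        have := hm i
        unfold Db Qm
        simp
        rw [mul_comm]
        refine mul_le_mul_of_nonneg_right ?_ hi.le
        split_ifs <;> linarith
      · unfold Db Qm
        simp only [hij, if_false, add_zero]
        split_ifs <;> first | omega | (apply le_of_eq; simp <;> ring) | skip
        all_goals first | tauto | skip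
    refine b.trans_lt ?_
    rw [Finset.sum_add_distrib, Finset.sum_add_distrib, Finset.sum_ite_eq']
    simp only [Finset.mem_univ, if_true]
    have a1 := sum_ite_le_aux (fun i : Fin n => (i : ℕ) + 1 = (j : ℕ))
      (fun j k hj hk => Fin.ext (by omega)) (fun i => d * η ^ (i : ℕ)) (d / η * η ^ (j : ℕ)) (by positivity)
      (fun i hi => by rw [← hi, pow_succ]; apply le_of_eq; field_simp)
    have a2 := sum_ite_le_aux (fun i : Fin n => (j : ℕ) + 1 = (i : ℕ))
      (fun j k hj hk => Fin.ext (by omega)) (fun i => (d + q) * η ^ (i : ℕ)) ((d + q) * η * η ^ (j : ℕ)) (by positivity)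
      (fun i hi => by rw [← hi, pow_succ]; apply le_of_eq; ring)
    nlinarith
  have h3 : ∑ j, φ j * ∑ i : Fin n, η ^ (i : ℕ) * (d * Db n i j + q * Qm n i j + (if i = j then r i else 0)) < 0 := by
    apply Finset.sum_neg
    · exact fun j _ => mul_neg_of_pos_of_neg (hφ j) (h2 j)
    · exact ⟨⟨0, by omega⟩, Finset.mem_univ _⟩
  linarith

lemma second_aux {n : ℕ} (hn : 2 ≤ n) {r φ v : Fin n → ℝ} {d q ds : ℝ} (hd : 0 < d) (hq : 0 < q)
    (hv : ∀ i, 0 < v i)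
    (hds : (ds • Db n + Matrix.diagonal r).mulVec v = 0)
    (hφ : ∀ i, 0 < φ i)
    (h : (d • Db n + q • Qm n + Matrix.diagonal r).mulVec φ = 0) (hds0 : 0 < ds) :
    d * (d + q) < ds ^ 2 := by
  by_contra hc
  push Not at hc
  obtain ⟨a, ha, had⟩ : ∃ a : ℝ, 0 < a ∧ a ^ 2 = d := ⟨√d, Real.sqrt_pos.2 hd, Real.sq_sqrt hd.le⟩
  obtain ⟨b, hb, hbd⟩ : ∃ b : ℝ, 0 < b ∧ b ^ 2 = d + q :=
    ⟨√(d + q), Real.sqrt_pos.2 (by linarith), Real.sq_sqrt (by linarith)⟩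
  have hab : a < b := by nlinarith
  have hs : ds ≤ a * b := by
    refine (sq_le_sq₀ hds0.le (by positivity)).1 ?_
    rw [mul_pow, had, hbd]; exact hc
  set w : Fin n → ℝ := fun i => (a / b) ^ (i : ℕ) with hw
  have hwp : ∀ i, 0 < w i := fun i => by simp only [hw]; positivity
  set u : Fin n → ℝ := fun i => φ i * w i with hu
  have hup : ∀ i, 0 < u i := fun i => mul_pos (hφ i) (hwp i)
  -- the null form
  have h0 : ∑ i, u i * w i * ∑ j, (d * Db n i j + q * Qm n i j + (if i = j then r i else 0)) * φ j = 0 :=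
    Finset.sum_eq_zero fun i _ => by rw [eqn_aux h i, mul_zero]
  have h1 : (0:ℝ) ≤ ∑ i, ∑ j, (a * b * (u i * Db n i j * u j)
      + (if i = j then (r i - (b - a) ^ 2) * (u i * u j) else 0)) := by
    refine h0.symm.le.trans ?_
    refine Finset.sum_le_sum fun i _ => ?_
    rw [Finset.mul_sum]
    refine Finset.sum_le_sum fun j _ => ?_
    have key : w i * (d * Db n i j + q * Qm n i j + (if i = j then r i else 0))
        ≤ (a * b * Db n i j + (if i = j then (r i - (b - a) ^ 2) else 0)) * w j := by
      by_cases hij : i = j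
      · subst hij
        rw [mul_comm]
        refine mul_le_mul_of_nonneg_right ?_ (hwp i).le
        unfold Db Qm
        simp
        split_ifs <;> nlinarith
      · unfold Db Qm
        simp only [hij, if_false, add_zero]
        by_cases c1 : (i : ℕ) + 1 = (j : ℕ)
        · have c2 : ¬ ((j : ℕ) + 1 = (i : ℕ)) := by omega
          simp only [c1, c2, hw, true_or, if_true, if_false]
          rw [← c1, pow_succ]
          apply le_of_eq
          rw [← had]
          field_simp
          ring
        · by_cases c2 : (j : ℕ) + 1 = (i : ℕ)
          · simp only [c1, c2, hw, or_true, if_true, if_false]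
            rw [← c2, pow_succ]
            apply le_of_eq
            have : d * 1 + q * 1 = b ^ 2 := by linarith
            rw [this]
            field_simp
          · simp [c1, c2]
    have hm : 0 ≤ u i * φ j := (mul_pos (hup i) (hφ j)).le
    have := mul_le_mul_of_nonneg_left key hm
    calc _ = _ := ?_
      _ ≤ _ := this
      _ = _ := ?_
    · ring
    · simp only [hu]
      split_ifs <;> ring
  have h2 : ∑ i, ∑ j, (a * b * (u i * Db n i j * u j)
      + (if i = j then (r i - (b - a) ^ 2) * (u i * u j) else 0))
      = a * b * (∑ i, ∑ j, u i * Db n i j * u j) + ∑ i, r i * u i ^ 2 - (b - a) ^ 2 * ∑ i, u i ^ 2 := by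
    simp only [Finset.sum_add_distrib, Finset.sum_ite_eq, Finset.mem_univ, if_true, Finset.mul_sum]
    rw [add_sub_assoc, ← Finset.sum_sub_distrib]
    congr 1
    refine Finset.sum_congr rfl fun i _ => ?_
    ring
  have h3 : ds * (∑ i, ∑ j, u i * Db n i j * u j) + ∑ i, r i * u i ^ 2 ≤ 0 := by
    have p := mul_le_mul_of_nonneg_left
      (perron_aux (Db n) (Db_symm_aux n) (Db_off_aux n) v hv u) hds0.le
    have e : ds * ∑ i, u i ^ 2 / v i * ∑ j, Db n i j * v j = - ∑ i, r i * u i ^ 2 := by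
      rw [Finset.mul_sum, ← Finset.sum_neg_distrib]
      refine Finset.sum_congr rfl fun i _ => ?_
      have e1 : ds * ∑ j, Db n i j * v j + r i * v i = 0 := by
        have := congrFun hds i
        rw [Matrix.add_mulVec, Matrix.smul_mulVec, Pi.add_apply, Matrix.mulVec_diagonal] at this
        simpa [Matrix.mulVec, dotProduct] using this
      have := (hv i).ne'
      have e2 : ds * ∑ j, Db n i j * v j = - (r i * v i) := by linarith
      calc _ = u i ^ 2 / v i * (ds * ∑ j, Db n i j * v j) := by ring
        _ = _ := by rw [e2]; field_simp
    linarith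
  have h4 := Db_neg_aux n u
  have h5 : 0 < ∑ i, u i ^ 2 :=
    Finset.sum_pos (fun i _ => pow_pos (hup i) 2) ⟨⟨0, by omega⟩, Finset.mem_univ _⟩
  have h6 : 0 < (b - a) ^ 2 * ∑ i, u i ^ 2 := mul_pos (pow_pos (by linarith) 2) h5
  nlinarith

/-- in case (b) with `max_i r_i > 0`, the critical advection rate satisfies
`q*_r(d) → max_i r_i` as `d → 0` and `q*_r(d) → 0` as `d → d*`, where `d*` is the unique
positive value at which `d*D + diag r` has eigenvalue `0` with a positive eigenvector. -/
theorem stmt_10 (n : ℕ) (hn : 2 ≤ n) (r : Fin n → ℝ) (hr : ∃ i, 0 < r i)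
    (m : ℝ) (hm : IsGreatest (Set.range r) m)
    (ds : ℝ) (hds : 0 < ds)
    (hds0 : ∃ φ : Fin n → ℝ, (∀ i, 0 < φ i) ∧
      (ds • Db n + Matrix.diagonal r).mulVec φ = 0)
    (hdsu : ∀ d' : ℝ, 0 < d' →
      (∃ φ : Fin n → ℝ, (∀ i, 0 < φ i) ∧
        (d' • Db n + Matrix.diagonal r).mulVec φ = 0) → d' = ds) :
    (∀ ε : ℝ, 0 < ε → ∃ δ : ℝ, 0 < δ ∧ ∀ d q : ℝ, 0 < d → d < δ → 0 < q →
      (∃ φ : Fin n → ℝ, (∀ i, 0 < φ i) ∧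
        (d • Db n + q • Qm n + Matrix.diagonal r).mulVec φ = 0) →
      |q - m| < ε) ∧
    (∀ ε : ℝ, 0 < ε → ∃ δ : ℝ, 0 < δ ∧ ∀ d q : ℝ, ds - δ < d → d < ds → 0 < q →
      (∃ φ : Fin n → ℝ, (∀ i, 0 < φ i) ∧
        (d • Db n + q • Qm n + Matrix.diagonal r).mulVec φ = 0) →
      q < ε) := by
  have hle : ∀ i, r i ≤ m := fun i => hm.2 ⟨i, rfl⟩
  obtain ⟨i0, hi0⟩ := hm.1
  have hmpos : 0 < m := by
    obtain ⟨i, hi⟩ := hr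
    exact hi.trans_le (hle i)
  constructor
  · intro ε hε
    obtain ⟨η, hη⟩ : ∃ η, η = ε / (2 * (m + ε)) := ⟨_, rfl⟩
    have hη0 : 0 < η := by rw [hη]; positivity
    have hη1 : η * (m + ε) = ε / 2 := by rw [hη]; field_simp
    have hη2 : η < 1 := by nlinarith
    refine ⟨η * (ε / 2), by positivity, ?_⟩
    rintro d q hd hdδ hq ⟨φ, hφ, h⟩
    have l := lower_aux hd hq hφ h i0
    have up := upper_aux hn hd hq hle hη0 hφ h
    rw [hi0] at l
    have hd2 : d / η < ε / 2 := by rw [div_lt_iff₀ hη0]; linarith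
    rw [abs_lt]
    constructor
    · nlinarith
    · by_contra hc
      push Not at hc
      nlinarith
  · intro ε hε
    obtain ⟨v, hv, hv0⟩ := hds0
    refine ⟨min (ds / 2) (ε / 4), by positivity, ?_⟩
    rintro d q hdl hdu hq ⟨φ, hφ, h⟩
    have m1 := min_le_left (ds / 2) (ε / 4)
    have m2 := min_le_right (ds / 2) (ε / 4)
    have hd : 0 < d := by linarith
    have := second_aux hn hd hq hv hv0 hφ h hds
    by_contra hc
    push Not at hc
    have g1 : ds - d < ε / 4 := by linarith
    have g2 : ds + d < 4 * d := by linarith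
    nlinarith
end

section
/- Consider case (b) with constant growth rate vector r·𝟙 = (r,…,r), where r > 0, and let d* > 0 be the unique value such that d*D + diag(r,…,r) has eigenvalue 0 with a positive eigenvector. Suppose d̄ ∈ (0,d*) and q̄ ∈ (0,r) are such that there exists φ ≫ 0 with (d̄D + q̄Q + diag(r,…,r))φ = 0. Then for all d, d′ with d̄ ≤ d < d′ < d* and all q, q′ > 0 such that dD + qQ + diag(r,…,r) and d′D + q′Q + diag(r,…,r) each have eigenvalue 0 with a positive eigenvector, one has r > q > q′. (That is, the critical advection rate q*(d) is strictly decreasing on [d̄, d*) once it drops below r.) -/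
open Matrix Filter

/-- extension by zero -/
noncomputable def extz (n : ℕ) (φ : Fin n → ℝ) : ℕ → ℝ := fun k => if h : k < n then φ ⟨k, h⟩ else 0

lemma row_eq_s11 (n : ℕ) (d q r : ℝ) (φ : Fin n → ℝ) (i : Fin n) :
    (d • Db n + q • Qm n + Matrix.diagonal (fun _ : Fin n => r)).mulVec φ i =
      (if (i : ℕ) = 0 then 0 else (d + q) * extz n φ ((i : ℕ) - 1)) + d * extz n φ ((i : ℕ) + 1)
       + (r - q - (if (i : ℕ) = 0 then d else 2 * d)) * extz n φ i := by
  have h1 : ∀ j : Fin n, (d • Db n + q • Qm n + Matrix.diagonal (fun _ : Fin n => r)) i j * φ j =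
      (fun k : ℕ => (if k + 1 = (i : ℕ) then (d + q) * extz n φ k else 0)
        + (if (i : ℕ) + 1 = k then d * extz n φ k else 0)
        + (if (i : ℕ) = k then
            (r - q - (if (i : ℕ) = 0 then d else 2 * d)) * extz n φ k else 0)) (j : ℕ) := by
    intro j
    have hj : extz n φ (j : ℕ) = φ j := by simp [extz]
    simp only [hj, Matrix.add_apply, Matrix.smul_apply, Matrix.diagonal_apply, Db, Qm, smul_eq_mul,
      Fin.ext_iff]
    split_ifs <;> first | (exfalso; omega) | ring
  have h0 : (d • Db n + q • Qm n + Matrix.diagonal (fun _ : Fin n => r)).mulVec φ i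
    = ∑ j : Fin n, (d • Db n + q • Qm n + Matrix.diagonal (fun _ : Fin n => r)) i j * φ j := rfl
  rw [h0, Finset.sum_congr rfl (fun j _ => h1 j), Fin.sum_univ_eq_sum_range
    (fun k : ℕ => (if k + 1 = (i : ℕ) then (d + q) * extz n φ k else 0)
        + (if (i : ℕ) + 1 = k then d * extz n φ k else 0)
        + (if (i : ℕ) = k then
            (r - q - (if (i : ℕ) = 0 then d else 2 * d)) * extz n φ k else 0)),
    Finset.sum_add_distrib,
    Finset.sum_add_distrib]
  congr 1
  · congr 1
    · split_ifs with hi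
      · apply Finset.sum_eq_zero
        intro k _
        rw [if_neg (by omega)]
      · rw [Finset.sum_eq_single ((i : ℕ) - 1)]
        · rw [if_pos (by omega)]
        · intro k _ hk
          rw [if_neg (by omega)]
        · intro hk
          exact absurd (Finset.mem_range.2 (by omega)) hk
    · rw [Finset.sum_ite_eq]
      split_ifs with hi
      · rfl
      · have : ¬ ((i : ℕ) + 1 < n) := by simpa using hi
        simp [extz, this]
  · rw [Finset.sum_ite_eq, if_pos (by simp)]

lemma get_seq (n : ℕ) (hn : 2 ≤ n) (d q r : ℝ) (hd : 0 < d)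
    (h : ∃ φ : Fin n → ℝ, (∀ i, 0 < φ i) ∧
      (d • Db n + q • Qm n + Matrix.diagonal (fun _ : Fin n => r)).mulVec φ = 0) :
    ∃ x : ℕ → ℝ, x 0 = r ∧ (∀ i, i + 1 < n → x i < d + q) ∧ x (n - 1) = d + q ∧
      ∀ i, i + 1 < n → x (i + 1) = r + d * x i / (d + q - x i) := by
  obtain ⟨φ, hp, he⟩ := h
  have hP : ∀ k, k < n → 0 < extz n φ k := by
    intro k hk
    simp [extz, hk, hp]
  have hz : extz n φ n = 0 := by simp [extz]
  have hrow : ∀ i : Fin n, _ := fun i => (row_eq_s11 n d q r φ i).symm.trans (congrFun he i)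
  refine ⟨fun i => (d + q) - d * extz n φ (i + 1) / extz n φ i, ?_, ?_, ?_, ?_⟩
  · have h0 := hrow ⟨0, by omega⟩
    have hp0 := hP 0 (by omega)
    simp at h0 ⊢
    field_simp
    linarith
  · intro i hi
    have h1 := hP i (by omega)
    have h2 := hP (i + 1) hi
    have : 0 < d * extz n φ (i + 1) / extz n φ i := by positivity
    simp only
    linarith
  · have : n - 1 + 1 = n := by omega
    simp [this, hz]
  · intro i hi
    have h1 := hP i (by omega)
    have h2 := hP (i + 1) hi
    have h0 := hrow ⟨i + 1, hi⟩
    simp at h0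
    simp only [sub_sub_cancel]
    field_simp
    linarith

lemma key (n : ℕ) (hn : 2 ≤ n) (d q d' q' r : ℝ) (hr : 0 < r) (hd : 0 < d)
    (hq : q < r) (hdd : d ≤ d') (hqq : q ≤ q')
    (h : ∃ φ : Fin n → ℝ, (∀ i, 0 < φ i) ∧
      (d • Db n + q • Qm n + Matrix.diagonal (fun _ : Fin n => r)).mulVec φ = 0)
    (h' : ∃ φ : Fin n → ℝ, (∀ i, 0 < φ i) ∧
      (d' • Db n + q' • Qm n + Matrix.diagonal (fun _ : Fin n => r)).mulVec φ = 0) :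
    d' + q' ≤ d + q := by
  obtain ⟨x, x0, xl, xn, xs⟩ := get_seq n hn d q r hd h
  obtain ⟨y, y0, yl, yn, ys⟩ := get_seq n hn d' q' r (by linarith) h'
  have hd' : 0 < d' := by linarith
  have main : ∀ i, i < n → r ≤ y i ∧ y i ≤ x i := by
    intro i
    induction i with
    | zero => intro _; rw [x0, y0]; exact ⟨le_rfl, le_rfl⟩
    | succ i ih =>
      intro hi
      obtain ⟨a, b⟩ := ih (by omega)
      have hx := xl i hi
      have hy := yl i hi
      rw [xs i hi, ys i hi]
      have hyp : 0 < y i := by linarith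
      have hA : 0 < d + q - x i := by linarith
      have hB : 0 < d' + q' - y i := by linarith
      have hC : 0 < d' + q - x i := by linarith
      constructor
      · have : 0 < d' * y i / (d' + q' - y i) := by positivity
        linarith
      · have e1 : d' * y i / (d' + q' - y i) ≤ d' * x i / (d' + q - x i) := by
          apply div_le_div₀ <;> nlinarith
        have e2 : d' * x i / (d' + q - x i) ≤ d * x i / (d + q - x i) := by
          rw [div_le_div_iff₀ hC hA]
          have : 0 ≤ x i * ((d' - d) * (x i - q)) :=
            mul_nonneg (by linarith) (mul_nonneg (by linarith) (by linarith))
          nlinarith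
        linarith
  have := (main (n - 1) (by omega)).2
  rw [xn, yn] at this
  exact this

/-- in case (b) with constant growth rate `r > 0`, if the critical advection
rate drops below `r` at some `d̄ ∈ (0, d*)`, then it is strictly decreasing (and below `r`)
on `[d̄, d*)`. -/
theorem stmt_11 (n : ℕ) (hn : 2 ≤ n) (r : ℝ) (hr : 0 < r)
    (ds : ℝ) (hds : 0 < ds)
    (hds0 : ∃ φ : Fin n → ℝ, (∀ i, 0 < φ i) ∧
      (ds • Db n + Matrix.diagonal (fun _ : Fin n => r)).mulVec φ = 0)
    (hdsu : ∀ d' : ℝ, 0 < d' →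
      (∃ φ : Fin n → ℝ, (∀ i, 0 < φ i) ∧
        (d' • Db n + Matrix.diagonal (fun _ : Fin n => r)).mulVec φ = 0) → d' = ds)
    (dbar qbar : ℝ) (hdbar0 : 0 < dbar) (hdbars : dbar < ds)
    (hqbar0 : 0 < qbar) (hqbarr : qbar < r)
    (hbar : ∃ φ : Fin n → ℝ, (∀ i, 0 < φ i) ∧
      (dbar • Db n + qbar • Qm n + Matrix.diagonal (fun _ : Fin n => r)).mulVec φ = 0) :
    ∀ d d' q q' : ℝ, dbar ≤ d → d < d' → d' < ds → 0 < q → 0 < q' →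
      (∃ φ : Fin n → ℝ, (∀ i, 0 < φ i) ∧
        (d • Db n + q • Qm n + Matrix.diagonal (fun _ : Fin n => r)).mulVec φ = 0) →
      (∃ φ : Fin n → ℝ, (∀ i, 0 < φ i) ∧
        (d' • Db n + q' • Qm n + Matrix.diagonal (fun _ : Fin n => r)).mulVec φ = 0) →
      q < r ∧ q' < q := by
  intro d d' q q' h1 h2 h3 hq hq' H H'
  have hqr : q < r := by
    by_contra hc
    have := key n hn dbar qbar d q r hr hdbar0 hqbarr h1 (by linarith) hbar H
    linarith
  refine ⟨hqr, ?_⟩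
  by_contra hc
  have := key n hn d q d' q' r hr (by linarith) hqr h2.le (by linarith) H H'
  linarith
end

section
/- Consider case (a). Let r > 0, d > 0, q > 0, and suppose u ∈ ℝⁿ with uᵢ > 0 for all i satisfies the single-species equilibrium system Σ_{j=1}^n (dD_{ij} + qQ_{ij})u_j + u_i(r − u_i) = 0 for every i = 1,…,n. Then 0 < u₁ < u₂ < ⋯ < uₙ < r. -/
open Matrix Filter

lemma aux_mono (N : ℕ) (r d q : ℝ) (hd : 0 < d) (hq : 0 < q) (v : ℕ → ℝ) (hv : ∀ k, 0 < v k)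
    (h0 : d * (v 1 - v 0) - q * v 0 + v 0 * (r - v 0) = 0)
    (hs : ∀ k, k < N → d * (v (k+2) - v (k+1)) - (d+q) * (v (k+1) - v k)
      + v (k+1) * (r - v (k+1)) = 0)
    (hend : v (N+1) = v N) : ∀ k, k < N → v k < v (k+1) := by
  by_contra hcon
  push Not at hcon
  classical
  have hk := Nat.find_spec hcon
  have hmin := fun m => @Nat.find_min _ _ hcon m
  generalize Nat.find hcon = k at hk hmin
  obtain ⟨hkN, hle⟩ := hk
  have hkr : v k < r := by
    have : 0 < v k * (r - v k) := by
      cases k with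
      | zero => nlinarith [mul_pos hq (hv 0)]
      | succ m =>
        have h1 := hmin m (by omega)
        have h2 : v m < v (m+1) := by
          by_contra h
          exact h1 ⟨by omega, not_lt.mp h⟩
        have h3 := hs m (by omega)
        have h4 : 0 < (d+q) * (v (m+1) - v m) := mul_pos (by linarith) (by linarith)
        nlinarith
    have := pos_of_mul_pos_right this (hv k).le
    linarith
  have key : ∀ m, k + m < N → v (k+m+1) < r ∧ v (k+m+2) < v (k+m+1) := by
    intro m
    induction m with
    | zero =>
      intro hm
      have hr1 : v (k+1) < r := by linarith
      refine ⟨hr1, ?_⟩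
      have h3 := hs k hm
      have h5 : 0 < v (k+1) * (r - v (k+1)) := mul_pos (hv _) (by linarith)
      have h4 : 0 ≤ (d+q) * (v k - v (k+1)) := mul_nonneg (by linarith) (by linarith)
      have h6 : 0 < d * (v (k+1) - v (k+2)) := by linarith
      have := pos_of_mul_pos_right h6 hd.le
      simp only [Nat.add_zero]
      linarith
    | succ m ih =>
      intro hm
      obtain ⟨a, b⟩ := ih (by omega)
      have h3 := hs (k+m+1) hm
      have hr1 : v (k+m+2) < r := by linarith
      refine ⟨hr1, ?_⟩
      have h5 : 0 < v (k+m+2) * (r - v (k+m+2)) := mul_pos (hv _) (by linarith)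
      have h4 : 0 ≤ (d+q) * (v (k+m+1) - v (k+m+2)) := mul_nonneg (by linarith) (by linarith)
      have h6 : 0 < d * (v (k+m+2) - v (k+m+3)) := by
        simp only [show k+m+1+1 = k+m+2 from rfl, show k+m+1+2 = k+m+3 from rfl] at h3
        linarith
      have := pos_of_mul_pos_right h6 hd.le
      simp only [show k+(m+1)+1 = k+m+2 by omega, show k+(m+1)+2 = k+m+3 by omega]
      linarith
  have := (key (N-1-k) (by omega)).2
  rw [show k + (N-1-k) + 2 = N+1 by omega, show k + (N-1-k) + 1 = N by omega] at this
  linarith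

/-- in case (a), a positive equilibrium of the single-species patch model
with constant growth rate `r` satisfies `0 < u₁ < u₂ < ⋯ < uₙ < r`. -/
theorem stmt_12 (n : ℕ) (hn : 2 ≤ n) (r d q : ℝ) (hr : 0 < r) (hd : 0 < d) (hq : 0 < q)
    (u : Fin n → ℝ) (hu : ∀ i, 0 < u i)
    (heq : ∀ i, (∑ j, (d * Da n i j + q * Qm n i j) * u j) + u i * (r - u i) = 0) :
    StrictMono u ∧ ∀ i, u i < r := by
  obtain ⟨N, rfl⟩ : ∃ N, n = N + 1 := ⟨n-1, by omega⟩
  set v : ℕ → ℝ := fun k => u ⟨min k N, by omega⟩ with hvdef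
  have hvu : ∀ i : Fin (N+1), v i = u i := by
    intro i
    have : min (i:ℕ) N = i := by omega
    simp [hvdef, this]
  have hend : v (N+1) = v N := by simp [hvdef]
  have hv : ∀ k, 0 < v k := fun k => hu _
  have row : ∀ k, k < N+1 → (∑ j ∈ Finset.range (N+1),
      ((if j = k+1 then d * v j else 0) + (if j + 1 = k then (d+q) * v j else 0)
      + (if j = k then (d * (if k = 0 ∨ k = N then -1 else -2) - q) * v j else 0)))
      + v k * (r - v k) = 0 := by
    intro k hk
    have h := heq ⟨k, hk⟩
    rw [← hvu, ← Fin.sum_univ_eq_sum_range (fun j => ((if j = k+1 then d * v j else 0) + (if j + 1 = k then (d+q) * v j else 0)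
      + (if j = k then (d * (if k = 0 ∨ k = N then -1 else -2) - q) * v j else 0)))] at *
    refine Eq.trans ?_ h
    congr 1
    apply Finset.sum_congr rfl
    intro j _
    rw [← hvu j]
    simp only [Da, Qm, Fin.ext_iff, Nat.add_sub_cancel]
    split_ifs <;> first | (exfalso; omega) | ring
  have hmono := aux_mono N r d q hd hq v hv (by
      have h := row 0 (by omega)
      simp [Finset.sum_add_distrib, Finset.sum_ite_eq', show 0 < N by omega] at h
      linarith) (by
      intro k hk
      have h := row (k+1) (by omega)
      simp only [Finset.sum_add_distrib, Finset.sum_ite_eq', Nat.add_right_cancel_iff,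
        Finset.mem_range] at h
      rw [if_pos (show k < N+1 by omega), if_pos (show k+1 < N+1 by omega)] at h
      by_cases hkN : k + 1 = N
      · rw [if_neg (by omega), if_pos (by omega)] at h
        have e : v (k+2) = v (k+1) := by
          subst hkN; exact hend
        rw [e]; linarith
      · rw [if_pos (by omega), if_neg (by omega)] at h
        linarith) hend
  have hsm : StrictMono u := by
    rw [Fin.strictMono_iff_lt_succ]
    intro i
    rw [← hvu, ← hvu]
    exact hmono i i.2
  refine ⟨hsm, ?_⟩
  have hl : v N < r := by
    obtain ⟨M, rfl⟩ : ∃ M, N = M + 1 := ⟨N-1, by omega⟩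
    have h := row (M+1) (by omega)
    simp only [Finset.sum_add_distrib, Finset.sum_ite_eq', Nat.add_right_cancel_iff,
        Finset.mem_range] at h
    simp at h
    have h2 := hmono M (by omega)
    have h4 : 0 < (d+q) * (v (M+1) - v M) := mul_pos (by linarith) (by linarith)
    have h5 : 0 < v (M+1) * (r - v (M+1)) := by linarith
    have := pos_of_mul_pos_right h5 (hv _).le
    linarith
  intro i
  have : u i ≤ u (Fin.last N) := hsm.monotone (Fin.le_last i)
  rw [← hvu (Fin.last N)] at this
  exact lt_of_le_of_lt this hl
end

section
/- Consider case (b). Let r > 0, d > 0, q > 0, and suppose u ∈ ℝⁿ with uᵢ > 0 for all i satisfies the single-species equilibrium system Σ_{j=1}^n (dD_{ij} + qQ_{ij})u_j + u_i(r − u_i) = 0 for every i = 1,…,n. Then uᵢ < r for every i, i.e., 0 ≪ u ≪ (r,…,r). -/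
open Matrix Filter

lemma row_sum_aux (n : ℕ) (d q : ℝ) (u : Fin n → ℝ) (v : ℕ → ℝ)
    (hv : ∀ i : Fin n, v i = u i) (hv0 : v n = 0) (i : Fin n) :
    (∑ j, (d * Db n i j + q * Qm n i j) * u j) =
      d * v (i + 1) + (if (i : ℕ) = 0 then 0 else (d + q) * v (i - 1)) -
        (if (i : ℕ) = 0 then d + q else 2 * d + q) * v i := by
  have hi := i.2
  have h1 : ∀ j : Fin n, (d * Db n i j + q * Qm n i j) * u j =
      (fun k : ℕ => (if (i : ℕ) + 1 = k then d * v k else 0)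
        + (if (i : ℕ) = 0 then 0 else if (i : ℕ) - 1 = k then (d + q) * v k else 0)
        - (if (i : ℕ) = k then (if (i : ℕ) = 0 then d + q else 2 * d + q) * v k else 0)) j := by
    intro j
    simp only [Db, Qm, hv, Fin.ext_iff]
    split_ifs <;> first | omega | ring
  refine ((Finset.sum_congr rfl (fun j _ => h1 j)).trans (Fin.sum_univ_eq_sum_range
      (fun k : ℕ => (if (i : ℕ) + 1 = k then d * v k else 0)
        + (if (i : ℕ) = 0 then 0 else if (i : ℕ) - 1 = k then (d + q) * v k else 0)
        - (if (i : ℕ) = k then (if (i : ℕ) = 0 then d + q else 2 * d + q) * v k else 0)) n)).trans ?_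
  rw [Finset.sum_sub_distrib, Finset.sum_add_distrib]
  have e1 : ∑ k ∈ Finset.range n, (if (i : ℕ) + 1 = k then d * v k else 0) = d * v (i + 1) := by
    rw [Finset.sum_ite_eq]
    split_ifs with h
    · rfl
    · have : (i : ℕ) + 1 = n := by simp at h; omega
      rw [this, hv0]; ring
  have e3 : ∀ c : ℝ, ∑ k ∈ Finset.range n, (if (i : ℕ) = k then c * v k else 0) = c * v i := by
    intro c
    rw [Finset.sum_ite_eq, if_pos (by simp)]
  rw [e1, e3]
  by_cases h0 : (i : ℕ) = 0
  · simp [h0]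
  · simp only [h0, if_false]
    rw [Finset.sum_ite_eq, if_pos (by simp; omega)]

/-- in case (b), a positive equilibrium of the single-species patch model
with constant growth rate `r` satisfies `0 ≪ u ≪ (r,…,r)`. -/
theorem stmt_13 (n : ℕ) (hn : 2 ≤ n) (r d q : ℝ) (hr : 0 < r) (hd : 0 < d) (hq : 0 < q)
    (u : Fin n → ℝ) (hu : ∀ i, 0 < u i)
    (heq : ∀ i, (∑ j, (d * Db n i j + q * Qm n i j) * u j) + u i * (r - u i) = 0) :
    ∀ i, u i < r := by
  classical
  obtain ⟨v, hv, hv0⟩ : ∃ v : ℕ → ℝ, (∀ i : Fin n, v i = u i) ∧ ∀ k, n ≤ k → v k = 0 :=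
    ⟨fun k => if h : k < n then u ⟨k, h⟩ else 0, fun i => by simp, fun k hk => by
      simp [Nat.not_lt.mpr hk]⟩
  have hex : ∃ k : ℕ, k < n ∧ ∀ j : Fin n, u j ≤ v k := by
    haveI : Nonempty (Fin n) := ⟨⟨0, by omega⟩⟩
    obtain ⟨m, hm⟩ := Finite.exists_max u
    exact ⟨m, m.2, fun j => by rw [hv]; exact hm j⟩
  obtain ⟨m, ⟨hmn, hm⟩, hmin⟩ : ∃ m, (m < n ∧ ∀ j : Fin n, u j ≤ v m) ∧
      ∀ k < m, ¬ (k < n ∧ ∀ j : Fin n, u j ≤ v k) :=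
    ⟨Nat.find hex, Nat.find_spec hex, fun k hk => Nat.find_min hex hk⟩
  have e := heq ⟨m, hmn⟩
  rw [row_sum_aux n d q u v hv (hv0 n le_rfl), ← hv] at e
  simp only at e
  have hpos : 0 < v m := by
    have := hu ⟨m, hmn⟩
    rwa [← hv] at this
  have hle : ∀ k, v k ≤ v m := by
    intro k
    by_cases hk : k < n
    · have := hm ⟨k, hk⟩
      rwa [← hv] at this
    · rw [hv0 k (by omega)]; exact hpos.le
  have key : v m < r := by
    by_contra hc
    push Not at hc
    have h1 : v m * (r - v m) ≤ 0 := mul_nonpos_of_nonneg_of_nonpos hpos.le (by linarith)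
    have h2 : d * v (m + 1) ≤ d * v m := mul_le_mul_of_nonneg_left (hle _) hd.le
    by_cases h0 : m = 0
    · simp only [h0, if_true] at e h1 h2 hpos
      have := mul_pos hq hpos
      linarith
    · simp only [h0, if_false] at e
      have h3 : v (m - 1) < v m := by
        by_contra h
        push Not at h
        exact hmin (m - 1) (by omega) ⟨by omega, fun j => (hm j).trans h⟩
      have h4 := mul_lt_mul_of_pos_left h3 (add_pos hd hq)
      linarith
  intro i
  exact (hm i).trans_lt key
end
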